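/- arXiv:1704.07306 — 2 statements merged into one kernel-verified Lean document; each statement's English description precedes it below -/
import Mathlib

section
/- Let M be a connected GF(4)-representable matroid that has a {U_{2,5}, U_{3,5}}-minor and a circuit-hyperplane X such that the relaxation of M at X is 3-connected and GF(4)-representable. Suppose that M has no proper minor M₀ such that M₀ is connected, M₀ has a {U_{2,5}, U_{3,5}}-minor, and M₀ has a circuit-hyperplane whose relaxation is 3-connected and GF(4)-representable. Then M is {U_{2,5}, U_{3,5}}-fragile. -/
open Matroid Set
open scoped Classical

namespace Relax

variable {α β : Type*}

/-- A circuit of a matroid: a minimal dependent set. -/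
def Circuit (M : Matroid α) (C : Set α) : Prop :=
  M.Dep C ∧ ∀ D ⊂ C, M.Indep D

/-- A hyperplane of a matroid: a maximal proper flat. -/
def Hyperplane (M : Matroid α) (H : Set α) : Prop :=
  M.IsFlat H ∧ H ≠ M.E ∧ ∀ F, M.IsFlat F → H ⊂ F → F = M.E

/-- `X` is a circuit-hyperplane of `M`. -/
def CircuitHyperplane (M : Matroid α) (X : Set α) : Prop :=
  Circuit M X ∧ Hyperplane M X

/-- `M'` is obtained from `M` by relaxing the circuit-hyperplane `X` : the ground set is
unchanged and the bases of `M'` are exactly the bases of `M` together with `X`. -/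
def IsRelaxation (M M' : Matroid α) (X : Set α) : Prop :=
  CircuitHyperplane M X ∧ M'.E = M.E ∧ ∀ B, (M'.IsBase B ↔ M.IsBase B ∨ B = X)

/-- A matroid is representable over a field `F` if there is an assignment of vectors to its
elements under which independence coincides with linear independence. -/
def Representable (M : Matroid α) (F : Type*) [Field F] : Prop :=
  ∃ (n : ℕ) (φ : α → (Fin n → F)), ∀ I ⊆ M.E,
    (M.Indep I ↔ LinearIndependent F (fun x : I => φ (x : α)))

/-- The field GF(4). -/
abbrev GF4 := GaloisField 2 2

/-- The rank of a set in a matroid: the maximum size of an independent subset. -/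
noncomputable def rk (M : Matroid α) (X : Set α) : ℕ :=
  sSup {n | ∃ I, M.Indep I ∧ I ⊆ X ∧ I.ncard = n}

/-- Deletion of a set of elements. -/
def delete (M : Matroid α) (D : Set α) : Matroid α := M ↾ (M.E \ D)

/-- Contraction of a set of elements. -/
def contract (M : Matroid α) (C : Set α) : Matroid α := (delete M✶ C)✶

/-- `N` is a minor of `M`. -/
def MinorOf (N M : Matroid α) : Prop :=
  ∃ C D, C ⊆ M.E ∧ D ⊆ M.E ∧ Disjoint C D ∧ N = delete (contract M C) D

/-- Isomorphism of matroids. -/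
def Iso (M : Matroid α) (N : Matroid β) : Prop :=
  ∃ e : M.E ≃ N.E, ∀ I : Set M.E,
    M.Indep ((↑) '' I) ↔ N.Indep ((↑) '' (e '' I))

/-- `M` has a minor isomorphic to `N`. -/
def HasMinorIso (M : Matroid α) (N : Matroid β) : Prop :=
  ∃ M₀ : Matroid α, MinorOf M₀ M ∧ Iso M₀ N

/-- `M` has a minor isomorphic to a member of the set `𝒩` of matroids. -/
def HasMinorIn (M : Matroid α) (𝒩 : Set (Matroid β)) : Prop :=
  ∃ N ∈ 𝒩, HasMinorIso M N

/-- `M` is `𝒩`-fragile. -/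
def Fragile (M : Matroid α) (𝒩 : Set (Matroid β)) : Prop :=
  HasMinorIn M 𝒩 ∧
    ∀ a ∈ M.E, ¬ (HasMinorIn (delete M {a}) 𝒩 ∧ HasMinorIn (contract M {a}) 𝒩)

/-- `M` is (isomorphic to) the uniform matroid `U_{r,n}`. -/
def IsUniform (M : Matroid α) (r n : ℕ) : Prop :=
  M.E.Finite ∧ M.E.ncard = n ∧ ∀ I ⊆ M.E, (M.Indep I ↔ I.ncard ≤ r)

/-- `M` has a minor isomorphic to `U_{r,n}`. -/
def HasUnifMinor (M : Matroid α) (r n : ℕ) : Prop :=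
  ∃ M₀, MinorOf M₀ M ∧ IsUniform M₀ r n

/-- `M` has a `{U_{2,5}, U_{3,5}}`-minor. -/
def HasU25U35Minor (M : Matroid α) : Prop :=
  HasUnifMinor M 2 5 ∨ HasUnifMinor M 3 5

/-- `M` is `U_{2,4}`-fragile. -/
def FragileU24 (M : Matroid α) : Prop :=
  HasUnifMinor M 2 4 ∧
    ∀ a ∈ M.E, ¬ (HasUnifMinor (delete M {a}) 2 4 ∧ HasUnifMinor (contract M {a}) 2 4)

/-- `M` is `{U_{2,5}, U_{3,5}}`-fragile. -/
def FragileU25U35 (M : Matroid α) : Prop :=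
  HasU25U35Minor M ∧
    ∀ a ∈ M.E, ¬ (HasU25U35Minor (delete M {a}) ∧ HasU25U35Minor (contract M {a}))

/-- A loop. -/
def Loop (M : Matroid α) (x : α) : Prop := x ∈ M.E ∧ ¬ M.Indep {x}

/-- Two distinct non-loop elements are parallel if they form a two-element circuit. -/
def Parallel (M : Matroid α) (x y : α) : Prop := x ≠ y ∧ Circuit M {x, y}

/-- A parallel class: a maximal set of pairwise-parallel non-loop elements. -/
def ParallelClass (M : Matroid α) (A : Set α) : Prop :=
  A ⊆ M.E ∧ (∀ x ∈ A, ¬ Loop M x) ∧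
    (∀ x ∈ A, ∀ y ∈ A, x ≠ y → Parallel M x y) ∧
    (∀ B, A ⊆ B → B ⊆ M.E → (∀ x ∈ B, ¬ Loop M x) →
      (∀ x ∈ B, ∀ y ∈ B, x ≠ y → Parallel M x y) → B = A)

/-- A series class: a parallel class of the dual. -/
def SeriesClass (M : Matroid α) (A : Set α) : Prop := ParallelClass M✶ A

/-- A matroid is connected if every two distinct elements lie in a common circuit. -/
def Connected (M : Matroid α) : Prop :=
  ∀ x ∈ M.E, ∀ y ∈ M.E, x ≠ y → ∃ C, Circuit M C ∧ x ∈ C ∧ y ∈ C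

/-- A `k`-separation of `M`. -/
def Separation (M : Matroid α) (k : ℕ) (A B : Set α) : Prop :=
  A ∪ B = M.E ∧ Disjoint A B ∧ k ≤ A.ncard ∧ k ≤ B.ncard ∧
    rk M A + rk M B ≤ rk M M.E + (k - 1)

/-- A matroid is 3-connected if it is connected and has no 2-separation. -/
def ThreeConnected (M : Matroid α) : Prop :=
  Connected M ∧ ∀ A B, ¬ Separation M 2 A B

/-- `M` is 3-connected up to series and parallel classes. -/
def ThreeConnUpToSP (M : Matroid α) : Prop :=
  Connected M ∧ ∀ A B, Separation M 2 A B →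
    (SeriesClass M A ∨ ParallelClass M A ∨ SeriesClass M B ∨ ParallelClass M B)

/-- A 3-separating set of `M`. -/
def ThreeSeparating (M : Matroid α) (Y : Set α) : Prop :=
  Y ⊆ M.E ∧ rk M Y + rk M (M.E \ Y) ≤ rk M M.E + 2

/-- `M` has path width 3: there is an ordering of the ground set all of whose initial
segments are 3-separating. -/
def PathWidth3 (M : Matroid α) : Prop :=
  ∃ (n : ℕ) (e : Fin n → α), Function.Injective e ∧ Set.range e = M.E ∧
    ∀ t : Fin n, ThreeSeparating M (e '' {i | i ≤ t})

/-- A segment: every 3-element subset is a triangle. -/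
def Segment (M : Matroid α) (S : Set α) : Prop :=
  S ⊆ M.E ∧ ∀ T ⊆ S, T.ncard = 3 → Circuit M T

/-- A triangle: a 3-element circuit. -/
def Triangle (M : Matroid α) (S : Set α) : Prop := Circuit M S ∧ S.ncard = 3

/-! ### Reduced representations `[I | C]` with `C = [[A, 1], [1ᵀ, w]]` -/

/-- The column, indexed by `x`, of the matrix `[I | C]` whose rows are indexed by
`(X \ {e}) ∪ {f}`, where `C` is the block matrix `[[A, 1], [1ᵀ, w]]` with row block `X \ {e}`,
column block `(E \ X) \ {f}`, last column `e`, last row `f`, and corner entry `w`. -/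
noncomputable def colVec (X : Set α) (e f : α) (A : α → α → GF4) (w : GF4) :
    α → ((X \ {e} ∪ {f} : Set α) → GF4) := fun x r =>
  if x ∈ X \ {e} ∪ ({f} : Set α) then (if (r : α) = x then 1 else 0)
  else if (r : α) = f then (if x = e then w else 1)
  else if x = e then 1 else A (r : α) x

/-- `M = M[I | C]` where `C` is the block matrix `[[A, 1], [1ᵀ, w]]` relative to the
basis `(X \ {e}) ∪ {f}`. -/
def RepBy (M : Matroid α) (X : Set α) (e f : α) (A : α → α → GF4) (w : GF4) : Prop :=
  ∀ I ⊆ M.E, (M.Indep I ↔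
    LinearIndependent GF4 (fun x : I => colVec X e f A w (x : α)))

/-- The matrix `B`, with rows restricted to `R` and columns restricted to `K`, has an
`m × n` submatrix (up to permuting rows and columns) equal to the pattern `P`. -/
def HasPattern {m n : ℕ} (B : α → α → GF4) (R K : Set α) (P : Fin m → Fin n → GF4) : Prop :=
  ∃ (r : Fin m → α) (c : Fin n → α), Function.Injective r ∧ Function.Injective c ∧
    (∀ i, r i ∈ R) ∧ (∀ j, c j ∈ K) ∧ ∀ i j, B (r i) (c j) = P i j

/-- One non-zero element of GF(4). -/
def NZ1 (x : GF4) : Prop := x ≠ 0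

/-- Two distinct non-zero elements of GF(4). -/
def NZ2 (x y : GF4) : Prop := x ≠ 0 ∧ y ≠ 0 ∧ x ≠ y

/-- Three distinct non-zero elements of GF(4). -/
def NZ3 (x y z : GF4) : Prop :=
  x ≠ 0 ∧ y ≠ 0 ∧ z ≠ 0 ∧ x ≠ y ∧ x ≠ z ∧ y ≠ z

/-- `B` (with rows from `R` and columns from `K`) contains one of the fifteen forbidden
submatrices, up to permuting rows and columns, where `x, y, z` denote distinct non-zero
elements of GF(4). -/
def HasForbidden (B : α → α → GF4) (R K : Set α) : Prop :=
  (∃ x y z, NZ3 x y z ∧ HasPattern B R K ![![x, y, z]]) ∨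
  (∃ x y, NZ2 x y ∧ HasPattern B R K ![![x, y], ![0, x]]) ∨
  (∃ x y, NZ2 x y ∧ HasPattern B R K ![![x, y], ![y, x]]) ∨
  (∃ x y z, NZ3 x y z ∧ HasPattern B R K ![![x, y], ![z, x]]) ∨
  (∃ x y z, NZ3 x y z ∧ HasPattern B R K ![![x, x], ![y, z]]) ∨
  (∃ x, NZ1 x ∧ HasPattern B R K ![![x, x, 0], ![x, 0, x]]) ∨
  (∃ x y, NZ2 x y ∧ HasPattern B R K ![![x, x, 0], ![x, 0, y]]) ∨
  (∃ x y, NZ2 x y ∧ HasPattern B R K ![![x, x, 0], ![y, 0, y]]) ∨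
  (∃ x y, NZ2 x y ∧ HasPattern B R K ![![x, y, 0], ![x, 0, y]]) ∨
  (∃ x y z, NZ3 x y z ∧ HasPattern B R K ![![x, 0, 0], ![0, y, z]]) ∨
  (∃ x, NZ1 x ∧ HasPattern B R K ![![x, 0, 0], ![0, x, 0], ![0, 0, x]]) ∨
  (∃ x y, NZ2 x y ∧ HasPattern B R K ![![x, 0, 0], ![0, x, 0], ![0, 0, y]]) ∨
  (∃ x y z, NZ3 x y z ∧ HasPattern B R K ![![x, 0, 0], ![0, y, 0], ![0, 0, z]]) ∨
  (∃ x y, NZ2 x y ∧ HasPattern B R K ![![x, y, x], ![y, y, 0], ![x, 0, 0]]) ∨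
  (∃ x y z, NZ3 x y z ∧ HasPattern B R K ![![x, y, x], ![y, y, 0], ![x, 0, z]])

/-! ### The matroids `P₈⁻`, `F₇⁼` and its dual -/

/-- The columns of the GF(3)-matrix `[I₄ | A]` representing `P₈`, where
`A = [[0,1,1,-1],[1,0,1,1],[1,1,0,1],[-1,1,1,0]]`. -/
def P8cols : Fin 8 → Fin 4 → ZMod 3 :=
  ![![1, 0, 0, 0], ![0, 1, 0, 0], ![0, 0, 1, 0], ![0, 0, 0, 1],
    ![0, 1, 1, -1], ![1, 0, 1, 1], ![1, 1, 0, 1], ![-1, 1, 1, 0]]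

/-- `M` is isomorphic to `P₈`. -/
def IsP8 (M : Matroid α) : Prop :=
  ∃ g : α → Fin 8, Set.BijOn g M.E Set.univ ∧
    ∀ I ⊆ M.E, (M.Indep I ↔ LinearIndependent (ZMod 3) (fun x : I => P8cols (g (x : α))))

/-- `M` is isomorphic to `P₈⁻`: it is obtained from a copy of `P₈` by relaxing one of its
pair of disjoint circuit-hyperplanes. -/
def IsP8Minus (M : Matroid α) : Prop :=
  ∃ (N : Matroid α) (X Y : Set α), IsP8 N ∧ CircuitHyperplane N Y ∧ Disjoint X Y ∧
    IsRelaxation N M X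

/-- The columns of the rational matrix representing the non-Fano matroid `F₇⁻`: the seven
non-zero `{0,1}`-vectors of length 3. -/
def F7cols : Fin 7 → Fin 3 → ℚ :=
  ![![1, 0, 0], ![0, 1, 0], ![0, 0, 1], ![1, 1, 0], ![1, 0, 1], ![0, 1, 1], ![1, 1, 1]]

/-- `M` is isomorphic to the non-Fano matroid `F₇⁻`. -/
def IsF7Minus (M : Matroid α) : Prop :=
  ∃ g : α → Fin 7, Set.BijOn g M.E Set.univ ∧
    ∀ I ⊆ M.E, (M.Indep I ↔ LinearIndependent ℚ (fun x : I => F7cols (g (x : α))))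

/-- `M` is isomorphic to `F₇⁼`: it is obtained from a copy of `F₇⁻` by relaxing a
circuit-hyperplane. -/
def IsF7Eq (M : Matroid α) : Prop :=
  ∃ (N : Matroid α) (X : Set α), IsF7Minus N ∧ IsRelaxation N M X

end Relax

namespace Relax

section Rank

variable {M : Matroid α} [M.Finite] {I P Q U W X Y Z C S : Set α} {a e : α} {k : ℕ}

theorem cast_rk (M : Matroid α) [M.Finite] (X : Set α) : (rk M X : ℕ∞) = M.eRk X := by
  obtain ⟨I, hI⟩ := M.exists_isBasis' X
  have hfin : I.Finite := M.set_finite I hI.indep.subset_ground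
  have hgreat : IsGreatest {n | ∃ I, M.Indep I ∧ I ⊆ X ∧ I.ncard = n} I.ncard := by
    refine ⟨⟨I, hI.indep, hI.subset, rfl⟩, ?_⟩
    rintro _ ⟨J, hJ, hJX, rfl⟩
    have h := hJ.encard_le_eRk_of_subset hJX
    rwa [← hI.encard_eq_eRk, ← (M.set_finite J hJ.subset_ground).cast_ncard_eq,
      ← hfin.cast_ncard_eq, Nat.cast_le] at h
  rw [rk, hgreat.csSup_eq, hfin.cast_ncard_eq, hI.encard_eq_eRk]

theorem rk_mono (h : X ⊆ Y) : rk M X ≤ rk M Y := by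
  have := M.eRk_mono h
  rwa [← cast_rk, ← cast_rk, Nat.cast_le] at this

/-- Submodularity, in a form that only asks for bounds on the union and the intersection. -/
theorem rk_submod (hU : U ⊆ P ∪ Q) (hI : I ⊆ P ∩ Q) :
    rk M U + rk M I ≤ rk M P + rk M Q := by
  have h := M.eRk_inter_add_eRk_union_le P Q
  simp only [← cast_rk] at h
  have h' : rk M (P ∩ Q) + rk M (P ∪ Q) ≤ rk M P + rk M Q := by exact_mod_cast h
  have := rk_mono (M := M) hU
  have := rk_mono (M := M) hI
  omega

theorem rk_empty : rk M ∅ = 0 := by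
  have := cast_rk M ∅
  rw [eRk_empty] at this
  exact_mod_cast this

theorem rk_union_le (hU : U ⊆ P ∪ Q) : rk M U ≤ rk M P + rk M Q := by
  have := rk_submod (M := M) hU (empty_subset _)
  omega

theorem rk_le_ncard (hX : X.Finite) : rk M X ≤ X.ncard := by
  have h := M.eRk_le_encard X
  rwa [← cast_rk, ← hX.cast_ncard_eq, Nat.cast_le] at h

theorem indep_iff_rk (hX : X.Finite) : M.Indep X ↔ rk M X = X.ncard := by
  rw [indep_iff_eRk_eq_encard_of_finite hX, ← cast_rk, ← hX.cast_ncard_eq, Nat.cast_inj]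

theorem rk_eq_of_indep (hX : M.Indep X) : rk M X = X.ncard :=
  (indep_iff_rk (M.set_finite X hX.subset_ground)).1 hX

theorem rk_eq_of_isBasis' (hI : M.IsBasis' I X) : rk M X = I.ncard := by
  rw [← rk_eq_of_indep hI.indep]
  have := hI.eRk_eq_eRk
  rw [← cast_rk, ← cast_rk, Nat.cast_inj] at this
  exact this.symm

theorem rk_ground_of_isBase (hI : M.IsBase I) : rk M M.E = I.ncard :=
  rk_eq_of_isBasis' hI.isBasis_ground.isBasis'

/-- If the rank of `W` over `P` agrees with its rank over a larger set `Q`, then so does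
the rank of every subset of `W`. -/
theorem rk_sandwich (hPQ : P ⊆ Q) (hZ : Z ⊆ W)
    (h : rk M (W ∪ Q) + rk M P = rk M (W ∪ P) + rk M Q) :
    rk M (Z ∪ Q) + rk M P = rk M (Z ∪ P) + rk M Q := by
  have h1 := rk_submod (M := M) (U := W ∪ Q) (I := Z ∪ P) (P := Z ∪ Q) (Q := W ∪ P)
    (by grind) (by grind)
  have h2 := rk_submod (M := M) (U := Z ∪ Q) (I := P) (P := Q) (Q := Z ∪ P)
    (by grind) (by grind)
  omega

end Rank

section UniformMinor

variable {M : Matroid α} [M.Finite] {C S Z : Set α} {a e : α} {k : ℕ}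

/-- Contracting `C` and restricting to `S` produces the uniform matroid `U_{k,5}`, expressed
by ranks in `M`. -/
def UniformOver (M : Matroid α) (k : ℕ) (C S : Set α) : Prop :=
  C ⊆ M.E ∧ S ⊆ M.E ∧ Disjoint C S ∧ S.ncard = 5 ∧
    ∀ Z ⊆ S, rk M (Z ∪ C) = rk M C + min Z.ncard k

theorem contract_indep_iff_rk (hC : C ⊆ M.E) (hZ : Z ⊆ M.E) (hCZ : Disjoint C Z) :
    (M ／ C).Indep Z ↔ rk M (Z ∪ C) = rk M C + Z.ncard := by
  obtain ⟨J, hJ⟩ := M.exists_isBasis C hC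
  have hJfin := M.set_finite J hJ.indep.subset_ground
  have hZfin := M.set_finite Z hZ
  have hd : Disjoint Z J := (hCZ.mono_left hJ.subset).symm
  have e1 : rk M (Z ∪ J) = rk M (Z ∪ C) := by
    have := hJ.eRk_eq_eRk_union Z
    rw [union_comm, union_comm C] at this
    rwa [← cast_rk, ← cast_rk, Nat.cast_inj] at this
  rw [hJ.contract_indep_iff_of_disjoint hCZ, indep_iff_rk (hZfin.union hJfin), e1,
    ncard_union_eq hd hZfin hJfin, rk_eq_of_isBasis' hJ.isBasis', add_comm]

theorem UniformOver.isUniform (h : UniformOver M k C S) :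
    IsUniform ((M ／ C) ＼ (M.E \ (C ∪ S))) k 5 := by
  obtain ⟨hC, hS, hd, h5, hr⟩ := h
  have hE : ((M ／ C) ＼ (M.E \ (C ∪ S))).E = S := by
    ext x
    have := @hS x
    have := hd.notMem_of_mem_left (a := x)
    simp only [delete_ground, contract_ground, mem_sdiff, mem_union]
    tauto
  refine ⟨by rw [hE]; exact M.set_finite S hS, by rw [hE]; exact h5, fun I hI => ?_⟩
  rw [hE] at hI
  rw [delete_indep_iff, contract_indep_iff_rk hC (hI.trans hS) (hd.mono_right hI), hr I hI]
  have : Disjoint I (M.E \ (C ∪ S)) := disjoint_left.2 fun x hx hx' => hx'.2 (.inr (hI hx))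
  simp [this]

theorem UniformOver.hasUnifMinor_delete (h : UniformOver M k C S) (hC : a ∉ C)
    (hS : a ∉ S) : HasUnifMinor (delete M {a}) k 5 := by
  refine ⟨_, ⟨C, M.E \ (C ∪ S ∪ {a}), ?_, ?_, ?_, rfl⟩, ?_⟩
  · exact fun x hx => ⟨h.1 hx, fun hxa => hC (hxa ▸ hx)⟩
  · exact fun x hx => ⟨hx.1, fun hxa => hx.2 (.inr hxa)⟩
  · exact disjoint_left.2 fun x hx hx' => hx'.2 (.inl (.inl hx))
  · have : delete (contract (delete M {a}) C) (M.E \ (C ∪ S ∪ {a})) =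
        (M ／ C) ＼ (M.E \ (C ∪ S)) := by
      change (M ＼ {a}) ／ C ＼ (M.E \ (C ∪ S ∪ {a})) = _
      rw [← contract_delete_comm _ (by simpa using hC), delete_delete,
        delete_eq_delete_iff]
      ext x
      by_cases hx : x = a <;> simp [hx, hC, hS]
    rw [this]
    exact h.isUniform

theorem UniformOver.hasUnifMinor_contract (h : UniformOver M k C S) (ha : a ∈ C) :
    HasUnifMinor (contract M {a}) k 5 := by
  have hE : (contract M {a}).E = M.E \ {a} := rfl
  refine ⟨_, ⟨C \ {a}, M.E \ (C ∪ S), ?_, ?_, ?_, rfl⟩, ?_⟩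
  · exact fun x hx => ⟨h.1 hx.1, hx.2⟩
  · exact fun x hx => ⟨hx.1, fun hxa => hx.2 (.inl (by rwa [mem_singleton_iff.1 hxa]))⟩
  · exact disjoint_left.2 fun x hx hx' => hx'.2 (.inl hx.1)
  · change IsUniform (M ／ {a} ／ (C \ {a}) ＼ (M.E \ (C ∪ S))) k 5
    rw [contract_contract, union_sdiff_cancel (by simpa using ha)]
    exact h.isUniform

theorem HasUnifMinor.exists_uniformOver (h : HasUnifMinor M k 5) :
    ∃ C S, UniformOver M k C S := by
  obtain ⟨_, ⟨C, D, hC, hD, hCD, rfl⟩, hfin, h5, hind⟩ := h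
  change ∀ I ⊆ (M.E \ C) \ D, ((M ／ C) ＼ D).Indep I ↔ _ at hind
  refine ⟨C, (M.E \ C) \ D, hC, sdiff_subset.trans sdiff_subset, ?_, h5, fun Z hZ => ?_⟩
  · exact disjoint_left.2 fun x hx hx' => hx'.1.2 hx
  have hZE : Z ⊆ M.E := hZ.trans (sdiff_subset.trans sdiff_subset)
  have key : ∀ I ⊆ Z, rk M (I ∪ C) = rk M C + I.ncard ↔ I.ncard ≤ k := fun I hI => by
    have hCI : Disjoint C I := disjoint_left.2 fun x hx hx' => (hZ (hI hx')).1.2 hx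
    have hDI : Disjoint I D := disjoint_left.2 fun x hx hx' => (hZ (hI hx)).2 hx'
    rw [← hind I (hI.trans hZ), delete_indep_iff,
      contract_indep_iff_rk hC (hI.trans hZE) hCI, and_iff_left hDI]
  have hZfin := M.set_finite Z hZE
  rcases le_total Z.ncard k with hk | hk
  · rw [min_eq_left hk, (key Z subset_rfl).2 hk]
  rw [min_eq_right hk]
  obtain ⟨I, hIZ, hIk⟩ := exists_subset_card_eq hk
  have h1 := (key I hIZ).2 hIk.le
  have h2 := rk_mono (M := M) (union_subset_union_left C hIZ)
  obtain ⟨J, hJ⟩ := M.exists_isBasis C hC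
  obtain ⟨K, hK, hJK⟩ := hJ.indep.subset_isBasis_of_subset
    (hJ.subset.trans (subset_union_right (s := Z))) (union_subset hZE hC)
  have hKfin := M.set_finite K hK.indep.subset_ground
  have h3 : K ∩ C = J := by
    refine (hJ.eq_of_subset_indep (hK.indep.subset inter_subset_left)
      (subset_inter hJK hJ.subset) inter_subset_right).symm
  have h4 : K \ C ⊆ Z := fun x hx => (hK.subset hx.1).resolve_right hx.2
  have h5 : (K ∩ C).ncard + (K \ C).ncard = K.ncard := ncard_inter_add_ncard_sdiff_eq_ncard K C hKfin
  have h6 := rk_eq_of_isBasis' hK.isBasis'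
  have h7 := rk_eq_of_isBasis' hJ.isBasis'
  have h8 : rk M ((K \ C) ∪ C) = rk M C + (K \ C).ncard := by
    have a1 := rk_mono (M := M) (X := K) (Y := (K \ C) ∪ C) (by simp)
    have a2 := rk_mono (M := M) (union_subset_union_left C h4)
    have a3 := rk_eq_of_indep hK.indep
    rw [h3] at h5
    omega
  have h9 := (key _ h4).1 h8
  rw [h3] at h5
  omega

end UniformMinor

theorem UniformOver.mono_right {M : Matroid α} {C C' S : Set α} {k : ℕ}
    (h : UniformOver M k C S) (hC' : C' ⊆ M.E)
    (hd : Disjoint C' S)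
    (hr : ∀ Z ⊆ S, rk M (Z ∪ C') + rk M C = rk M (Z ∪ C) + rk M C') :
    UniformOver M k C' S := by
  refine ⟨hC', h.2.1, hd, h.2.2.2.1, fun Z hZ => ?_⟩
  have := h.2.2.2.2 Z hZ
  have := hr Z hZ
  omega

section Reduction

variable {M : Matroid α} [M.Finite] {A B C S X Z : Set α} {a e t : α} {k : ℕ}

theorem exists_mem_notMem_of_ncard_inter_le_one (hA : 2 ≤ A.ncard) (hS : (S ∩ A).ncard ≤ 1) :
    ∃ a ∈ A, a ∉ S := by
  by_contra! h
  rw [inter_eq_self_of_subset_right h] at hS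
  omega

/-- If `A` has rank at most one, then some element of `A` can be deleted. -/
theorem UniformOver.exists_delete (h : UniformOver M k C S) (hk : 1 ≤ k)
    (hA : 2 ≤ A.ncard) (hrA : rk M A ≤ 1) (hS : (S ∩ A).ncard ≤ 1) :
    ∃ a ∈ A, HasUnifMinor (delete M {a}) k 5 := by
  obtain ⟨a, haA, haS⟩ := exists_mem_notMem_of_ncard_inter_le_one hA hS
  by_cases haC : a ∉ C
  · exact ⟨a, haA, h.hasUnifMinor_delete haC haS⟩
  rw [not_not] at haC
  obtain ⟨b, hbA, hba⟩ := exists_ne_of_one_lt_ncard hA a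
  have hab : rk M {a, b} ≤ 1 := (rk_mono (by grind)).trans hrA
  have drop : ∀ x ∈ C, (∀ Z, x ∉ Z → C \ {x} ⊆ Z → rk M (insert x Z) = rk M Z) →
      x ∉ S → HasUnifMinor (delete M {x}) k 5 := fun x hx hr hxS => by
    have h' : UniformOver M k (C \ {x}) S := by
      refine h.mono_right (sdiff_subset.trans h.1) (h.2.2.1.mono_left sdiff_subset) fun Z hZ => ?_
      rw [← hr (C \ {x}) (by simp) subset_rfl,
        ← hr (Z ∪ C \ {x}) (by grind) subset_union_right]
      have e1 : insert x (C \ {x}) = C := by grind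
      have e2 : insert x (Z ∪ C \ {x}) = Z ∪ C := by grind
      rw [e1, e2]
    exact h'.hasUnifMinor_delete (by simp) hxS
  by_cases ha0 : rk M {a} = 0
  · refine ⟨a, haA, drop a haC (fun Z _ _ => le_antisymm ?_ (rk_mono (subset_insert _ _))) haS⟩
    have := rk_union_le (M := M) (U := insert a Z) (P := {a}) (Q := Z) (by grind)
    omega
  have hb : ∀ Z, a ∈ Z → rk M (insert b Z) = rk M Z := fun Z hZ => by
    refine le_antisymm ?_ (rk_mono (subset_insert _ _))
    have := rk_submod (M := M) (U := insert b Z) (P := {a, b}) (Q := Z) (I := {a})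
      (by grind) (by grind)
    omega
  have hbS : b ∉ S := fun hbS => by
    have h1 := h.2.2.2.2 {b} (by simpa using hbS)
    have h2 := hb C haC
    rw [singleton_union, ncard_singleton, h2] at h1
    omega
  by_cases hbC : b ∈ C
  · exact ⟨b, hbA, drop b hbC (fun Z _ hZ => hb Z (hZ ⟨haC, fun h => hba h.symm⟩)) hbS⟩
  · exact ⟨b, hbA, h.hasUnifMinor_delete hbC hbS⟩

/-- If no two elements of `A` can be removed without lowering the rank, then some element
of `A` can be contracted. -/
theorem UniformOver.exists_contract (h : UniformOver M k C S) (hk : k ≤ 4) (hAE : A ⊆ M.E)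
    (hA : 2 ≤ A.ncard)
    (hrA : ∀ a ∈ A, ∀ b ∈ A, a ≠ b → rk M (M.E \ {a, b}) < rk M M.E)
    (hS : (S ∩ A).ncard ≤ 1) :
    ∃ a ∈ A, HasUnifMinor (contract M {a}) k 5 := by
  obtain ⟨a, haA, haS⟩ := exists_mem_notMem_of_ncard_inter_le_one hA hS
  by_cases haC : a ∈ C
  · exact ⟨a, haA, h.hasUnifMinor_contract haC⟩
  obtain ⟨b, hbA, hba⟩ := exists_ne_of_one_lt_ncard hA a
  have hab := hrA a haA b hbA hba.symm
  have step : ∀ x Z, rk M (insert x Z) ≤ rk M Z + 1 := fun x Z => by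
    have h1 := rk_union_le (M := M) (U := insert x Z) (P := {x}) (Q := Z) (by grind)
    have h2 := rk_le_ncard (M := M) (finite_singleton x)
    rw [ncard_singleton] at h2
    omega
  have add : ∀ x ∈ M.E, x ∉ S → (∀ Z, C ⊆ Z → Z ⊆ S ∪ C → rk M (insert x Z) = rk M Z + 1) →
      HasUnifMinor (contract M {x}) k 5 := fun x hx hxS hr => by
    have h' : UniformOver M k (insert x C) S := by
      refine h.mono_right (insert_subset hx h.1) (disjoint_insert_left.2 ⟨hxS, h.2.2.1⟩)
        fun Z hZ => ?_
      rw [union_insert, hr C subset_rfl subset_union_right,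
        hr (Z ∪ C) subset_union_right (union_subset_union_left _ hZ)]
      omega
    exact h'.hasUnifMinor_contract (mem_insert _ _)
  have hSC : S ∪ C ⊆ M.E := union_subset h.2.1 h.1
  by_cases ha : rk M (M.E \ {a}) < rk M M.E
  · refine ⟨a, haA, add a (hAE haA) haS fun Z hCZ hZ => le_antisymm (step _ _) ?_⟩
    have haZ : a ∉ Z := fun haZ => (hZ haZ).elim haS haC
    have hZE := hZ.trans hSC
    have := rk_submod (M := M) (U := M.E) (P := M.E \ {a}) (Q := insert a Z) (I := Z)
      (by grind) (by grind)
    omega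
  have hb : ∀ Z ⊆ M.E, a ∉ Z → b ∉ Z → rk M (insert b Z) = rk M Z + 1 := fun Z hZE haZ hbZ => by
    refine le_antisymm (step _ _) ?_
    have := rk_submod (M := M) (U := M.E \ {a}) (P := M.E \ {a, b}) (Q := insert b Z) (I := Z)
      (by grind) (by grind)
    omega
  have haSC : a ∉ S ∪ C := by simp [haS, haC]
  by_cases hbC : b ∈ C
  · exact ⟨b, hbA, h.hasUnifMinor_contract hbC⟩
  by_cases hbS : b ∈ S
  · exfalso
    have h1 := h.2.2.2.2 S subset_rfl
    have h2 := h.2.2.2.2 (S \ {b}) sdiff_subset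
    have h3 := hb (S \ {b} ∪ C) (by grind) (by grind) (by grind)
    have h4 : insert b (S \ {b} ∪ C) = S ∪ C := by grind
    have h5 := h.2.2.2.1
    have h6 := ncard_sdiff_singleton_add_one hbS (M.set_finite S h.2.1)
    rw [h4] at h3
    omega
  · exact ⟨b, hbA, add b (hAE hbA) hbS fun Z _ hZ =>
      hb Z (hZ.trans hSC) (fun h => haSC (hZ h)) (fun h => (hZ h).elim hbS hbC)⟩

theorem UniformOver.ncard_inter_le_one (h : UniformOver M k C S) (hk : k = 2 ∨ k = 3)
    (hAB : A ∪ B = M.E) (hd : Disjoint A B) (hsep : rk M A + rk M B ≤ rk M M.E + 1) :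
    (S ∩ A).ncard ≤ 1 ∨ (S ∩ B).ncard ≤ 1 := by
  have hCE := h.1
  have hSfin := M.set_finite S h.2.1
  have hcard : (S ∩ A).ncard + (S ∩ B).ncard = S.ncard := by
    rw [← ncard_union_eq (hd.mono inter_subset_right inter_subset_right)
      (hSfin.inter_of_left _) (hSfin.inter_of_left _), ← inter_union_distrib_left, hAB,
      inter_eq_self_of_subset_left h.2.1]
  have h0 := h.2.2.2.2 S subset_rfl
  have hA := h.2.2.2.2 (S ∩ A) inter_subset_left
  have hB := h.2.2.2.2 (S ∩ B) inter_subset_left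
  have r1 := rk_submod (M := M) (U := M.E) (I := (S ∪ C) ∩ A) (P := A)
    (Q := ((S ∪ C) ∩ A) ∪ B) (by grind) (by grind)
  have r2 := rk_submod (M := M) (U := ((S ∪ C) ∩ A) ∪ B) (I := (S ∪ C) ∩ B) (P := B)
    (Q := S ∪ C) (by grind) (by grind)
  have r3 := rk_submod (M := M) (U := S ∩ A ∪ C) (I := C ∩ A) (P := (S ∪ C) ∩ A) (Q := C)
    (by grind) (by grind)
  have r4 := rk_submod (M := M) (U := S ∩ B ∪ C) (I := C ∩ B) (P := (S ∪ C) ∩ B) (Q := C)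
    (by grind) (by grind)
  have r5 := rk_union_le (M := M) (U := C) (P := C ∩ A) (Q := C ∩ B) (by grind)
  have h5 := h.2.2.2.1
  rcases hk with rfl | rfl <;> omega

end Reduction

section Crossing

variable {M : Matroid α} [M.Finite] {A B C D S T X Y Z : Set α} {a e s t : α} {k : ℕ}

/-- If `S` lies inside `B`, then in passing from `C` either to `C ∩ B` or to `A ∪ C` the
restriction to `S` of the contraction does not change. -/
theorem UniformOver.inter_or_union (h : UniformOver M k C S) (hAB : A ∪ B = M.E)
    (hd : Disjoint A B) (hsep : rk M A + rk M B ≤ rk M M.E + 1) (hSB : S ⊆ B) :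
    UniformOver M k (C ∩ B) S ∨ UniformOver M k (A ∪ C) S := by
  have hCE := h.1
  have hCS := h.2.2.1
  have r1 := rk_union_le (M := M) (U := A ∪ C) (P := A) (Q := C ∩ B) (by grind)
  have r2 := rk_submod (M := M) (U := M.E) (I := S ∪ C ∩ B) (P := B) (Q := S ∪ (A ∪ C))
    (by clear r1 hsep h; grind) (by clear r1 hsep h; grind)
  have r3 := rk_submod (M := M) (U := S ∪ C) (I := C ∩ B) (P := S ∪ C ∩ B) (Q := C)
    (by clear r1 r2 hsep h; grind) (by clear r1 r2 hsep h; grind)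
  have r4 := rk_submod (M := M) (U := S ∪ (A ∪ C)) (I := C) (P := S ∪ C) (Q := A ∪ C)
    (by clear r1 r2 r3 hsep h; grind) (by clear r1 r2 r3 hsep h; grind)
  by_cases hμ : rk M (S ∪ C) + rk M (C ∩ B) = rk M (S ∪ C ∩ B) + rk M C
  · refine .inl (h.mono_right (inter_subset_left.trans hCE)
      (hCS.mono_left inter_subset_left) fun Z hZ => ?_)
    have := rk_sandwich (M := M) (inter_subset_left (s := C) (t := B)) hZ hμ
    omega
  · exact .inr (h.mono_right (union_subset (hAB ▸ subset_union_left) hCE)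
      (disjoint_union_left.2 ⟨hd.mono_right hSB, hCS⟩)
      fun Z hZ => rk_sandwich (M := M) subset_union_right hZ (by omega))

/-- If `s ∈ A` and `T ⊆ B`, with `S = insert s T`, then the rank of subsets of `T` over `C ∩ B`
is the rank over `C`, and the rank over `A ∪ C ∩ B` is the rank over `insert s C`. -/
theorem UniformOver.rk_inter_and_rk_union (h : UniformOver M k C (insert s T))
    (hk : k = 2 ∨ k = 3) (hAB : A ∪ B = M.E) (hd : Disjoint A B)
    (hsep : rk M A + rk M B ≤ rk M M.E + 1) (hTB : T ⊆ B) (hsA : s ∈ A) (hT : T.ncard = 4) :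
    (∀ Z ⊆ T, rk M (Z ∪ C ∩ B) = rk M (C ∩ B) + min Z.ncard k) ∧
    ∀ Z ⊆ T, rk M (Z ∪ (A ∪ C ∩ B)) + 1 = rk M (A ∪ C ∩ B) + min (Z.ncard + 1) k := by
  obtain ⟨hCE, hSE, hCS, hS5, hr⟩ := h
  have hTfin : T.Finite := finite_of_ncard_ne_zero (by omega)
  have hsT : s ∉ T := fun hs => disjoint_left.1 hd hsA (hTB hs)
  have rT : ∀ Z ⊆ T, rk M (Z ∪ C) = rk M C + min Z.ncard k := fun Z hZ =>
    hr Z (hZ.trans (subset_insert _ _))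
  have rsT : ∀ Z ⊆ T, rk M (Z ∪ insert s C) = rk M C + min (Z.ncard + 1) k := fun Z hZ => by
    have := hr (insert s Z) (insert_subset_insert hZ)
    rwa [ncard_insert_of_notMem (fun h => hsT (hZ h)) (hTfin.subset hZ), insert_union,
      ← union_insert] at this
  have c1 := rT T subset_rfl
  have c2 := rsT T subset_rfl
  have c3 := rsT ∅ (empty_subset _)
  rw [ncard_empty, empty_union] at c3
  have r1 := rk_union_le (M := M) (U := A ∪ C ∩ B) (P := A) (Q := C ∩ B) subset_rfl
  have hsub : insert s C ⊆ A ∪ C ∩ B := insert_subset (.inl hsA) fun x hx =>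
    (hAB.symm.subset (hCE hx)).imp_right fun hB => ⟨hx, hB⟩
  have r2 := rk_submod (M := M) (U := M.E) (I := T ∪ C ∩ B) (P := B) (Q := T ∪ (A ∪ C ∩ B))
    (by rw [← hAB]; exact union_subset (fun x hx => .inr (.inr (.inl hx))) subset_union_left)
    (subset_inter (union_subset hTB inter_subset_right)
      (union_subset_union_right _ subset_union_right))
  have r3 := rk_submod (M := M) (U := T ∪ C) (I := C ∩ B) (P := T ∪ C ∩ B) (Q := C)
    (union_subset_union_left _ subset_union_left)
    (subset_inter subset_union_right inter_subset_left)
  have r4 := rk_submod (M := M) (U := T ∪ (A ∪ C ∩ B)) (I := insert s C) (P := T ∪ insert s C)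
    (Q := A ∪ C ∩ B) (union_subset_union_left _ subset_union_left)
    (subset_inter subset_union_right hsub)
  constructor
  · intro Z hZ
    have := rk_sandwich (M := M) (P := C ∩ B) (Q := C) inter_subset_left hZ (by omega)
    have := rT Z hZ
    omega
  · intro Z hZ
    have := rk_sandwich (M := M) (P := insert s C) (Q := A ∪ C ∩ B) hsub hZ (by omega)
    have := rsT Z hZ
    omega

/-- Let `S = insert s T`, where `s ∈ A` and `T ⊆ B`, and let `hD`, `hA` describe the ranks of the
subsets of `T` over `D` and over `A ∪ D`. If `B` spans `t` together with `Y \ {t}`, then `t` can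
take the place of `s`, at the cost of contracting `Y \ {t}`. -/
theorem uniformOver_insert (hk : k = 2 ∨ k = 3) (hAB : A ∪ B = M.E) (hd : Disjoint A B)
    (hsep : rk M A + rk M B ≤ rk M M.E + 1) (hTB : T ⊆ B) (hDB : D ⊆ B) (hDT : Disjoint D T)
    (hT : T.ncard = 4) (hYA : Y ⊆ A) (htY : t ∈ Y) (hY : rk M Y = rk M (Y \ {t}) + 1)
    (hBY : rk M (B ∪ Y) = rk M (B ∪ Y \ {t}))
    (hD : ∀ Z ⊆ T, rk M (Z ∪ D) = rk M D + min Z.ncard k)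
    (hA : ∀ Z ⊆ T, rk M (Z ∪ (A ∪ D)) + 1 = rk M (A ∪ D) + min (Z.ncard + 1) k) :
    UniformOver M k (D ∪ Y \ {t}) (insert t T) := by
  have hTfin : T.Finite := finite_of_ncard_ne_zero (by omega)
  have htT : t ∉ T := fun h => disjoint_left.1 hd (hYA htY) (hTB h)
  have hY' : Y \ {t} ⊆ A := sdiff_subset.trans hYA
  have r2 := rk_submod (M := M) (U := M.E) (I := T ∪ D) (P := B) (Q := T ∪ (A ∪ D))
    (by rw [← hAB]; exact union_subset (fun x hx => .inr (.inr (.inl hx))) subset_union_left)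
    (subset_inter (union_subset hTB hDB) (union_subset_union_right _ subset_union_right))
  have q4 := rk_submod (M := M) (U := A ∪ D) (I := Y) (P := D ∪ Y) (Q := A)
    (by rw [union_comm A]; exact union_subset_union_left _ subset_union_left)
    (subset_inter subset_union_right hYA)
  have q6 := rk_union_le (M := M) (U := D ∪ Y) (P := D) (Q := Y) subset_rfl
  have q7 := rk_union_le (M := M) (U := D ∪ Y \ {t}) (P := D) (Q := Y \ {t}) subset_rfl
  have q8 := rk_submod (M := M) (U := B ∪ Y \ {t}) (I := T ∪ D) (P := B)
    (Q := T ∪ (D ∪ Y \ {t}))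
    (union_subset_union_right _ (subset_union_right.trans subset_union_right))
    (subset_inter (union_subset hTB hDB) (union_subset_union_right _ subset_union_left))
  have q9 := rk_submod (M := M) (U := T ∪ (D ∪ Y \ {t})) (I := D) (P := T ∪ D)
    (Q := D ∪ Y \ {t}) (union_subset_union_left _ subset_union_left)
    (subset_inter subset_union_right subset_union_left)
  have hDYA : D ∪ Y ⊆ A ∪ D := union_subset subset_union_right (hYA.trans subset_union_left)
  have q10 := rk_submod (M := M) (U := M.E) (I := T ∪ (D ∪ Y)) (P := B ∪ Y)
    (Q := T ∪ (A ∪ D))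
    (by rw [← hAB]
        exact union_subset (fun x hx => .inr (.inr (.inl hx))) (fun x hx => .inl (.inl hx)))
    (subset_inter (union_subset (hTB.trans subset_union_left) (union_subset_union_left _ hDB))
      (union_subset_union_right _ hDYA))
  have q11 := rk_submod (M := M) (U := T ∪ (A ∪ D)) (I := D ∪ Y) (P := T ∪ (D ∪ Y))
    (Q := A ∪ D) (union_subset_union_left _ subset_union_left)
    (subset_inter subset_union_right hDYA)
  have cD := hD T subset_rfl
  have cA := hA T subset_rfl
  have u1 : ∀ Z ⊆ T, rk M (Z ∪ (D ∪ Y \ {t})) = rk M (D ∪ Y \ {t}) + min Z.ncard k :=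
    fun Z hZ => by
      have := rk_sandwich (M := M) (P := D) (Q := D ∪ Y \ {t}) subset_union_left hZ (by omega)
      have := hD Z hZ
      omega
  have u2 : ∀ Z ⊆ T, rk M (Z ∪ (D ∪ Y)) = rk M (D ∪ Y \ {t}) + min (Z.ncard + 1) k :=
    fun Z hZ => by
      have := rk_sandwich (M := M) (P := D ∪ Y) (Q := A ∪ D) hDYA hZ (by omega)
      have := hA Z hZ
      omega
  have hE : ∀ x, x ∈ A ∨ x ∈ B → x ∈ M.E := fun x hx => hAB ▸ hx
  refine ⟨union_subset (fun x hx => hE x (.inr (hDB hx))) fun x hx => hE x (.inl (hY' hx)),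
    insert_subset (hE t (.inl (hYA htY))) fun x hx => hE x (.inr (hTB hx)), ?_, ?_,
    fun Z hZ => ?_⟩
  · rw [disjoint_insert_right, disjoint_union_left]
    refine ⟨?_, hDT, (hd.mono hY' hTB)⟩
    rintro (h | h)
    · exact disjoint_left.1 hd (hYA htY) (hDB h)
    · exact h.2 rfl
  · rw [ncard_insert_of_notMem htT hTfin, hT]
  · by_cases htZ : t ∈ Z
    · have hc := ncard_sdiff_singleton_add_one htZ ((hTfin.insert t).subset hZ)
      have := u2 (Z \ {t}) (by rwa [sdiff_singleton_subset_iff])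
      rw [hc] at this
      rw [← this]
      congr 1
      ext x
      by_cases hx : x = t <;> simp [hx, htZ, htY]
    · exact u1 Z ((subset_insert_iff_of_notMem htZ).1 hZ)

/-- Across a 2-separation both of whose sides meet the circuit `X`, an element of the small
side `A` outside `X` can be deleted or one inside `X` can be contracted. -/
theorem UniformOver.exists_reduction_of_crossing (h : UniformOver M k C S) (hk : k = 2 ∨ k = 3)
    (hAB : A ∪ B = M.E) (hd : Disjoint A B) (hsep : rk M A + rk M B ≤ rk M M.E + 1)
    (hXE : X ⊆ M.E) (hcirc : ∀ x ∈ X, rk M (X \ {x}) = rk M X)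
    (hind : ∀ Y ⊂ X, rk M Y = Y.ncard)
    (htX : t ∈ X) (htA : t ∈ A) (haX : a ∉ X) (haA : a ∈ A) (hXB : (X ∩ B).Nonempty)
    (hS : (S ∩ A).ncard ≤ 1) :
    HasUnifMinor (delete M {a}) k 5 ∨ HasUnifMinor (contract M {t}) k 5 := by
  have hSfin := M.set_finite S h.2.1
  rcases (S ∩ A).eq_empty_or_nonempty with hSA | ⟨s, hsS, hsA⟩
  · have hSB : S ⊆ B := fun x hx =>
      (hAB.symm.subset (h.2.1 hx)).resolve_left fun hxA => by
        simpa [hSA] using (show x ∈ S ∩ A from ⟨hx, hxA⟩)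
    have haS : a ∉ S := fun haS => disjoint_left.1 hd haA (hSB haS)
    rcases h.inter_or_union hAB hd hsep hSB with h' | h'
    · exact .inl (h'.hasUnifMinor_delete (fun ha => disjoint_left.1 hd haA ha.2) haS)
    · exact .inr (h'.hasUnifMinor_contract (.inl htA))
  · left
    have hSA : ∀ x ∈ S, x ∈ A → x = s := fun x hx hxA =>
      (ncard_le_one (hSfin.inter_of_left A)).1 hS x ⟨hx, hxA⟩ s ⟨hsS, hsA⟩
    obtain ⟨T, hsT, rfl⟩ : ∃ T, s ∉ T ∧ insert s T = S :=
      ⟨S \ {s}, by simp, by simp [insert_eq_of_mem hsS]⟩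
    have hTB : T ⊆ B := fun x hx =>
      (hAB.symm.subset (h.2.1 (.inr hx))).resolve_left fun hxA =>
        hsT (hSA x (.inr hx) hxA ▸ hx)
    have hT : T.ncard = 4 := by
      have := h.2.2.2.1
      rw [ncard_insert_of_notMem hsT (hSfin.subset (subset_insert _ _))] at this
      omega
    obtain ⟨hD, hA⟩ := h.rk_inter_and_rk_union hk hAB hd hsep hTB hsA hT
    obtain ⟨b, hbX, hbB⟩ := hXB
    have hYX : X ∩ A ⊂ X := ⟨inter_subset_left, fun hsub => disjoint_left.1 hd (hsub hbX).2 hbB⟩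
    have htY : t ∈ X ∩ A := ⟨htX, htA⟩
    have y1 := hind _ hYX
    have y2 := hind ((X ∩ A) \ {t}) (ssubset_of_subset_of_ssubset sdiff_subset hYX)
    have y3 := ncard_sdiff_singleton_add_one htY ((M.set_finite X hXE).inter_of_left A)
    have y4 := hcirc t htX
    have q1 := rk_submod (M := M) (U := B ∪ X ∩ A) (I := X \ {t}) (P := B ∪ (X ∩ A) \ {t})
      (Q := X) (union_subset (fun x hx => .inl (.inl hx)) fun x hx => .inr hx.1)
      (subset_inter (fun x hx => (hAB.symm.subset (hXE hx.1)).symm.imp_right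
        fun hxA => ⟨⟨hx.1, hxA⟩, hx.2⟩) sdiff_subset)
    have q2 := rk_mono (M := M) (X := B ∪ (X ∩ A) \ {t}) (Y := B ∪ X ∩ A)
      (union_subset_union_right _ sdiff_subset)
    have h' := uniformOver_insert hk hAB hd hsep hTB inter_subset_right
      ((h.2.2.1.mono_right (subset_insert _ _)).mono_left inter_subset_left) hT
      inter_subset_right htY (by omega) (by omega) hD hA
    refine h'.hasUnifMinor_delete ?_ ?_
    · rintro (ha | ha)
      · exact disjoint_left.1 hd haA ha.2
      · exact haX ha.1.1
    · rintro (ha | ha)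
      · exact haX (ha ▸ htX)
      · exact disjoint_left.1 hd haA (hTB ha)

end Crossing

section Relaxation

variable {α : Type*} {M M' : Matroid α} {B X : Set α} {e f x y : α}

theorem circuit_iff_isCircuit {C : Set α} : Circuit M C ↔ M.IsCircuit C :=
  isCircuit_iff_forall_ssubset.symm

/-- In terms of bases: a circuit-hyperplane is a nonbasis that becomes a basis whenever one of
its elements is exchanged for an element outside it. -/
theorem circuitHyperplane_iff [M.Finite] : CircuitHyperplane M X ↔
    X ⊆ M.E ∧ X.Nonempty ∧ (M.E \ X).Nonempty ∧ ¬ M.IsBase X ∧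
      ∀ x ∈ X, ∀ y ∈ M.E \ X, M.IsBase (insert y (X \ {x})) := by
  constructor
  · rintro ⟨hC, hF, hne, hmax⟩
    rw [circuit_iff_isCircuit] at hC
    have hXE := hC.subset_ground
    refine ⟨hXE, hC.nonempty, sdiff_nonempty.2 fun h => hne (hXE.antisymm h),
      fun h => hC.not_indep h.indep, fun x hx y hy => ?_⟩
    have hcl : M.closure (X \ {x}) = X := by rw [hC.closure_sdiff_singleton_eq, hF.closure]
    have hE : insert y (X \ {x}) ⊆ M.E := insert_subset hy.1 (sdiff_subset.trans hXE)
    have hXy : X ⊆ M.closure (insert y (X \ {x})) :=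
      hcl.symm.subset.trans (M.closure_subset_closure (subset_insert _ _))
    rw [isBase_iff_indep_closure_eq]
    refine ⟨?_, hmax _ (M.isFlat_closure _) (hXy.ssubset_of_mem_notMem
      (M.subset_closure _ hE (mem_insert y _)) hy.2)⟩
    rw [(hC.sdiff_singleton_indep hx).insert_indep_iff, hcl]
    exact .inl hy
  · rintro ⟨hXE, ⟨x, hx⟩, ⟨y, hy⟩, hB, h⟩
    have hXfin := M.set_finite X hXE
    have hC : M.IsCircuit X := by
      refine isCircuit_iff_forall_ssubset.2 ⟨⟨fun hi => hB ?_, hXE⟩, fun D hD => ?_⟩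
      · obtain ⟨B, hBase, hXB⟩ := hi.exists_isBase_superset
        have hcard := hBase.ncard_eq_ncard_of_isBase (h x hx y hy)
        rw [ncard_insert_of_notMem (fun h => hy.2 h.1) hXfin.sdiff,
          ncard_sdiff_singleton_add_one hx hXfin] at hcard
        rwa [eq_of_subset_of_ncard_le hXB hcard.le (M.set_finite B hBase.subset_ground)]
      · obtain ⟨z, hz, hzD⟩ := exists_of_ssubset hD
        exact (h z hz y hy).indep.subset fun w hw =>
          .inr ⟨hD.subset hw, fun hwz => hzD (hwz ▸ hw)⟩
    refine ⟨circuit_iff_isCircuit.2 hC, ?_, fun hXE' => hy.2 (hXE' ▸ hy.1), fun F hF hXF => ?_⟩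
    · rw [isFlat_iff_closure_eq]
      refine (M.subset_closure X hXE).antisymm' fun z hz => by_contra fun hzX => ?_
      have hzE := M.closure_subset_ground X hz
      have hi := (h x hx z ⟨hzE, hzX⟩).indep
      rw [(hC.sdiff_singleton_indep hx).insert_indep_iff_of_notMem (fun h => hzX h.1)] at hi
      exact hi.2 (hC.closure_sdiff_singleton_eq x ▸ hz)
    · obtain ⟨z, hzF, hzX⟩ := exists_of_ssubset hXF
      refine hF.subset_ground.antisymm ?_
      rw [← (h x hx z ⟨hF.subset_ground hzF, hzX⟩).closure_eq, ← hF.closure]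
      exact M.closure_subset_closure
        (insert_subset hzF (sdiff_subset.trans hXF.subset))

theorem IsRelaxation.dual [M.Finite] (h : IsRelaxation M M' X) :
    IsRelaxation M✶ M'✶ (M.E \ X) := by
  obtain ⟨hX, hE, hB⟩ := h
  obtain ⟨hXE, hne, hne', hXB, hswap⟩ := circuitHyperplane_iff.1 hX
  have hcompl : M.E \ (M.E \ X) = X := sdiff_sdiff_cancel_left hXE
  refine ⟨circuitHyperplane_iff.2 ⟨sdiff_subset, hne', by rwa [dual_ground, hcompl], ?_, ?_⟩, hE,
    fun B => ?_⟩
  · rwa [dual_isBase_iff sdiff_subset, hcompl]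
  · rw [dual_ground, hcompl]
    intro x hx y hy
    rw [dual_isBase_iff (insert_subset (hXE hy) (sdiff_subset.trans sdiff_subset))]
    convert hswap y hy x hx using 1
    ext z
    by_cases hzx : z = x
    · subst hzx; simp [hx.1, hx.2]; grind
    · grind
  · rw [dual_isBase_iff', dual_isBase_iff', hB, hE]
    constructor
    · rintro ⟨h | h, hBE⟩
      · exact .inl ⟨h, hBE⟩
      · right; rw [← h, sdiff_sdiff_cancel_left hBE]
    · rintro (⟨h, hBE⟩ | rfl)
      · exact ⟨.inl h, hBE⟩
      · exact ⟨.inr hcompl, sdiff_subset⟩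

theorem isRelaxation_delete [M.Finite] (h : IsRelaxation M M' X) (he : e ∈ M.E \ X)
    (hf : f ∈ M.E \ X) (hef : e ≠ f) : IsRelaxation (delete M {e}) (delete M' {e}) X := by
  obtain ⟨hX, hE, hB⟩ := h
  obtain ⟨hXE, ⟨x, hx⟩, hne', hXB, hswap⟩ := circuitHyperplane_iff.1 hX
  have hdisj : ∀ B : Set α, Disjoint B {e} ↔ e ∉ B := fun B => disjoint_singleton_right
  have hfB := hswap x hx f hf
  have hfe : insert f (X \ {x}) ⊆ M.E \ {e} := fun z hz => by
    refine ⟨hfB.subset_ground hz, ?_⟩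
    rintro rfl
    exact hz.elim hef fun h => he.2 h.1
  have hMe : M.Coindep {e} := coindep_iff_exists'.2 ⟨⟨_, hfB, hfe⟩, by simpa using he.1⟩
  have hMe' : M'.Coindep {e} :=
    coindep_iff_exists'.2 ⟨⟨_, (hB _).2 (.inl hfB), hE ▸ hfe⟩, by simpa [hE] using he.1⟩
  have hbase : ∀ B, (delete M {e}).IsBase B ↔ M.IsBase B ∧ e ∉ B := fun B => by
    rw [← hdisj]; exact hMe.delete_isBase_iff
  have hbase' : ∀ B, (delete M' {e}).IsBase B ↔ M'.IsBase B ∧ e ∉ B := fun B => by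
    rw [← hdisj]; exact hMe'.delete_isBase_iff
  have hfin : (Relax.delete M {e}).Finite := inferInstanceAs (M ＼ {e}).Finite
  refine ⟨circuitHyperplane_iff.2 ⟨?_, ⟨x, hx⟩, ⟨f, ⟨hf.1, hef.symm⟩, hf.2⟩,
    fun h => hXB ((hbase X).1 h).1, fun z hz y hy => (hbase _).2 ⟨hswap z hz y ⟨hy.1.1, hy.2⟩, ?_⟩⟩,
    congrArg (· \ ({e} : Set α)) hE, fun B => ?_⟩
  · exact fun z hz => ⟨hXE hz, fun hze => he.2 (hze ▸ hz)⟩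
  · rintro (rfl | h)
    · exact hy.1.2 rfl
    · exact he.2 h.1
  · rw [hbase, hbase', hB]
    constructor
    · rintro ⟨h | h, heB⟩
      exacts [.inl ⟨h, heB⟩, .inr h]
    · rintro (h | rfl)
      exacts [⟨.inl h.1, h.2⟩, ⟨.inr rfl, he.2⟩]

theorem isRelaxation_contract [M.Finite] (h : IsRelaxation M M' X) (he : e ∈ X)
    (hf : f ∈ X) (hef : e ≠ f) :
    IsRelaxation (contract M {e}) (contract M' {e}) (X \ {e}) := by
  have hXE := (circuitHyperplane_iff.1 h.1).1
  have hfin : (Relax.delete M✶ {e}).Finite := inferInstanceAs (M✶ ＼ {e}).Finite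
  have h' := (isRelaxation_delete h.dual (e := e) (f := f) ⟨hXE he, fun h => h.2 he⟩
    ⟨hXE hf, fun h => h.2 hf⟩ hef).dual
  have hX : X \ {e} = (Relax.delete M✶ {e}).E \ (M.E \ X) := by
    change X \ {e} = (M.E \ {e}) \ (M.E \ X)
    grind
  rw [hX]
  exact h'

end Relaxation

section Representable

variable {α F : Type*} [Field F] {M : Matroid α} {e : α}

theorem Representable.delete (h : Representable M F) (D : Set α) :
    Representable (Relax.delete M D) F := by
  obtain ⟨n, φ, hφ⟩ := h
  refine ⟨n, φ, fun I hI => ?_⟩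
  change I ⊆ M.E \ D at hI
  rw [← hφ I (hI.trans sdiff_subset)]
  exact delete_indep_iff.trans (and_iff_left (disjoint_sdiff_left.mono_left hI))

theorem Representable.contract (h : Representable M F) (he : M.IsNonloop e) :
    Representable (Relax.contract M {e}) F := by
  obtain ⟨n, φ, hφ⟩ := h
  let p := Submodule.span F (φ '' {e})
  let ψ : ((Fin n → F) ⧸ p) ≃ₗ[F] (Fin (Module.finrank F ((Fin n → F) ⧸ p)) → F) :=
    LinearEquiv.ofFinrankEq _ _ (by simp)
  refine ⟨_, fun x => ψ (p.mkQ (φ x)), fun I hI => ?_⟩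
  change I ⊆ M.E \ {e} at hI
  have heI : e ∉ I := fun h => (hI h).2 rfl
  have hs : LinearIndepOn F φ {e} := (hφ _ (by simpa using he.mem_ground)).1 he.indep
  have h1 : (Relax.contract M {e}).Indep I ↔ M.Indep (insert e I) :=
    he.contractElem_indep_iff.trans (and_iff_right heI)
  rw [h1, hφ _ (insert_subset he.mem_ground (hI.trans sdiff_subset))]
  change LinearIndepOn F φ (insert e I) ↔ _
  rw [insert_eq, ← hs.quotient_iff_union (disjoint_singleton_left.2 heI)]
  exact (LinearMap.linearIndependent_iff ψ.toLinearMap ψ.ker).symm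

end Representable

section Minor

variable {α : Type*} {M N : Matroid α}

theorem minorOf_iff_isMinor : MinorOf N M ↔ N ≤m M := by
  constructor
  · rintro ⟨C, D, -, -, -, rfl⟩
    exact ⟨C, D, rfl⟩
  · intro h
    obtain ⟨C, D, hC, hD, hCD, rfl⟩ := h.exists_eq_contract_delete_disjoint
    exact ⟨C, D, hC, hD, hCD, rfl⟩

end Minor

section Connected

variable {α : Type*} {M M' : Matroid α} {B X : Set α} {x y : α}

theorem exists_circuit_of_exchange (hB : M.IsBase B) (hy : y ∈ M.E \ B)
    (h : M.IsBase (insert y (B \ {x}))) : ∃ C, Circuit M C ∧ x ∈ C ∧ y ∈ C := by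
  have hyB : y ∈ M.closure B := by rw [hB.closure_eq]; exact hy.1
  refine ⟨_, circuit_iff_isCircuit.2 (hB.fundCircuit_isCircuit hy.1 hy.2), ?_,
    M.mem_fundCircuit _ _⟩
  rw [hB.indep.mem_fundCircuit_iff hyB hy.2]
  exact h.indep.subset (by grind)

theorem exists_circuit_of_mem_iff_mem (hX : X.Nonempty) (hX' : (M.E \ X).Nonempty)
    (h : ∀ x ∈ X, ∀ y ∈ M.E \ X, M.IsBase (insert y (X \ {x}))) (hx : x ∈ M.E) (hy : y ∈ M.E)
    (hxy : x ≠ y) (hiff : x ∈ X ↔ y ∈ X) : ∃ C, Circuit M C ∧ x ∈ C ∧ y ∈ C := by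
  obtain ⟨a, ha⟩ := hX
  obtain ⟨b, hb⟩ := hX'
  by_cases hxX : x ∈ X
  · have hyX := hiff.1 hxX
    obtain ⟨C, hC, hyC, hxC⟩ := exists_circuit_of_exchange (x := y) (y := x) (h x hxX b hb)
      ⟨hx, by grind⟩ (by convert h y hyX b hb using 1; grind)
    exact ⟨C, hC, hxC, hyC⟩
  · have hyX : y ∉ X := fun h => hxX (hiff.2 h)
    exact exists_circuit_of_exchange (h a ha x ⟨hx, hxX⟩) ⟨hy, by grind⟩
      (by convert h a ha y ⟨hy, hyX⟩ using 1; grind)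

/-- A relaxation is connected. -/
theorem IsRelaxation.connected_right [M.Finite] (h : IsRelaxation M M' X) : Connected M' := by
  obtain ⟨hX, hE, hB⟩ := h
  obtain ⟨hXE, hne, hne', hXB, hswap⟩ := circuitHyperplane_iff.1 hX
  rw [← hE] at hXE hne'
  have hswap' : ∀ x ∈ X, ∀ y ∈ M'.E \ X, M'.IsBase (insert y (X \ {x})) := fun x hx y hy =>
    (hB _).2 (.inl (hswap x hx y (hE ▸ hy)))
  have hXB' : M'.IsBase X := (hB X).2 (.inr rfl)
  intro x hx y hy hxy
  by_cases hiff : x ∈ X ↔ y ∈ X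
  · exact exists_circuit_of_mem_iff_mem hne hne' hswap' hx hy hxy hiff
  by_cases hxX : x ∈ X
  · have hyX : y ∈ M'.E \ X := ⟨hy, fun h => hiff ⟨fun _ => h, fun _ => hxX⟩⟩
    exact exists_circuit_of_exchange hXB' hyX (hswap' x hxX y hyX)
  · have hyX : y ∈ X := by tauto
    obtain ⟨C, hC, hyC, hxC⟩ := exists_circuit_of_exchange hXB' ⟨hx, hxX⟩
      (hswap' y hyX x ⟨hx, hxX⟩)
    exact ⟨C, hC, hxC, hyC⟩

/-- If `y` is in the ground set of the relaxation but not in `X`, and the complement of `X` has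
rank at least two, then `y` lies in a basis that differs from `X` by exchanging two elements,
one of which is the given element `x`. -/
theorem IsRelaxation.exists_isBase [M.Finite] (h : IsRelaxation M M' X)
    (hr : 2 ≤ rk M' (M.E \ X)) (hx : x ∈ X) (hy : y ∈ M.E \ X) :
    ∃ a ∈ X, ∃ z ∈ M.E \ X, a ≠ x ∧ z ≠ y ∧ M.IsBase (insert z (insert y (X \ {a, x}))) := by
  obtain ⟨hX, hE, hB⟩ := h
  obtain ⟨hXE, -, -, -, hswap⟩ := circuitHyperplane_iff.1 hX
  have hfin' : M'.Finite := ⟨hE ▸ M.ground_finite⟩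
  have hXfin := M.set_finite X hXE
  have hB1 : M'.IsBase (insert y (X \ {x})) := (hB _).2 (.inl (hswap x hx y hy))
  obtain ⟨I, hI⟩ := M'.exists_isBasis' (M.E \ X)
  rw [rk_eq_of_isBasis' hI] at hr
  have hIfin := M'.set_finite I hI.indep.subset_ground
  obtain ⟨z, ⟨hzI, hzy⟩, hzi⟩ := (hB1.indep.subset
    (singleton_subset_iff.2 (mem_insert y _))).augment hI.indep (by
      rw [encard_singleton, ← hIfin.cast_ncard_eq]
      exact_mod_cast hr)
  have hzX := hI.subset hzI
  replace hzy : z ≠ y := hzy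
  obtain ⟨B, hBase, hsub, hB2⟩ := hzi.exists_isBase_subset_union_isBase hB1
  have hyB : y ∈ B := hsub (by simp)
  have hzB : z ∈ B := hsub (by simp)
  have hcard := hBase.ncard_eq_ncard_of_isBase ((hB _).2 (.inr rfl) : M'.IsBase X)
  have hBfin := M'.set_finite B hBase.subset_ground
  have hx1 := ncard_sdiff_singleton_add_one hx hXfin
  obtain ⟨a, ⟨haX, hax⟩, haB⟩ : ∃ a ∈ X \ {x}, a ∉ B := by
    by_contra! hcon
    have hle := ncard_le_ncard (s := insert z (insert y (X \ {x}))) (t := B)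
      (insert_subset hzB (insert_subset hyB hcon)) hBfin
    rw [ncard_insert_of_notMem (by grind) (hXfin.sdiff.insert _),
      ncard_insert_of_notMem (by grind) hXfin.sdiff] at hle
    omega
  replace hax : a ≠ x := hax
  refine ⟨a, haX, z, hzX, hax, hzy, ?_⟩
  have hBX : B ≠ X := fun h => hy.2 (h ▸ hyB)
  have heq : B = insert z (insert y (X \ {a, x})) := by
    refine eq_of_subset_of_ncard_le (fun w hw => ?_) ?_ ((hXfin.sdiff.insert _).insert _)
    · have := hB2 hw
      grind
    · have h1 := ncard_insert_le z (insert y (X \ {a, x}))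
      have h2 := ncard_insert_le y (X \ {a, x})
      have h3 := ncard_sdiff_singleton_add_one (s := X \ {x}) (a := a) ⟨haX, hax⟩ hXfin.sdiff
      have h4 : (X \ {x}) \ {a} = X \ {a, x} := by grind
      rw [h4] at h3
      omega
  exact heq ▸ ((hB B).1 hBase).resolve_right hBX

/-- A matroid is connected if one of its relaxations has no 2-separation. -/
theorem IsRelaxation.connected_left [M.Finite] (h : IsRelaxation M M' X)
    (hsep : ∀ A B, ¬ Separation M' 2 A B) (hX2 : 2 ≤ X.ncard) (hX2' : 2 ≤ (M.E \ X).ncard) :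
    Connected M := by
  obtain ⟨hX, hE, hB⟩ := id h
  obtain ⟨hXE, hne, hne', hXB, hswap⟩ := circuitHyperplane_iff.1 hX
  have hfin' : M'.Finite := ⟨hE ▸ M.ground_finite⟩
  have hXB' : M'.IsBase X := (hB X).2 (.inr rfl)
  have hr : 2 ≤ rk M' (M.E \ X) := by
    by_contra! hlt
    refine hsep X (M.E \ X) ⟨by rw [union_sdiff_cancel hXE, hE], disjoint_sdiff_right, hX2, hX2',
      ?_⟩
    rw [rk_eq_of_indep hXB'.indep, rk_ground_of_isBase hXB']
    omega
  have hmix : ∀ x ∈ X, ∀ y ∈ M.E \ X, ∃ C, Circuit M C ∧ x ∈ C ∧ y ∈ C := fun x hx y hy => by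
    obtain ⟨a, ha, z, hz, hax, hzy, hbase⟩ := h.exists_isBase hr hx hy
    refine exists_circuit_of_exchange (hswap a ha z hz) ⟨hy.1, by grind⟩ ?_
    convert hbase using 1
    grind
  intro x hx y hy hxy
  by_cases hiff : x ∈ X ↔ y ∈ X
  · exact exists_circuit_of_mem_iff_mem hne hne' hswap hx hy hxy hiff
  by_cases hxX : x ∈ X
  · exact hmix x hxX y ⟨hy, fun h => hiff ⟨fun _ => h, fun _ => hxX⟩⟩
  · obtain ⟨C, hC, hyC, hxC⟩ := hmix y (by tauto) x ⟨hx, hxX⟩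
    exact ⟨C, hC, hxC, hyC⟩

end Connected

section Fragile

theorem hasU25U35Minor_iff {α : Type*} {M : Matroid α} :
    HasU25U35Minor M ↔ ∃ k, (k = 2 ∨ k = 3) ∧ HasUnifMinor M k 5 := by
  simp [HasU25U35Minor]

variable {α F : Type*} [Field F] {M M' : Matroid α} [M.Finite] {A B C S X : Set α} {e : α} {k : ℕ}

theorem IsRelaxation.finite_right (h : IsRelaxation M M' X) : M'.Finite :=
  ⟨h.2.1 ▸ M.ground_finite⟩

theorem IsRelaxation.rk_le (h : IsRelaxation M M' X) (A : Set α) : rk M A ≤ rk M' A := by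
  have := h.finite_right
  obtain ⟨I, hI⟩ := M.exists_isBasis' A
  obtain ⟨B, hB, hIB⟩ := hI.indep.exists_isBase_superset
  have hI' : M'.Indep I := ((h.2.2 B).2 (.inl hB)).indep.subset hIB
  rw [rk_eq_of_isBasis' hI, ← rk_eq_of_indep hI']
  exact rk_mono hI.subset

theorem IsRelaxation.rk_right (h : IsRelaxation M M' X) : rk M' X = X.ncard := by
  have := h.finite_right
  exact rk_eq_of_indep ((h.2.2 X).2 (.inr rfl)).indep

theorem IsRelaxation.rk_ground_right (h : IsRelaxation M M' X) : rk M' M.E = X.ncard := by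
  have := h.finite_right
  rw [← h.2.1, rk_ground_of_isBase ((h.2.2 X).2 (.inr rfl))]

theorem IsRelaxation.rk_ground_left (h : IsRelaxation M M' X) : rk M M.E = X.ncard := by
  obtain ⟨hXE, ⟨x, hx⟩, ⟨y, hy⟩, -, hswap⟩ := circuitHyperplane_iff.1 h.1
  have hXfin := M.set_finite X hXE
  rw [rk_ground_of_isBase (hswap x hx y hy), ncard_insert_of_notMem (fun h => hy.2 h.1)
    hXfin.sdiff, ncard_sdiff_singleton_add_one hx hXfin]

theorem UniformOver.two_le_ncard (h : UniformOver M k C S) (hk : k = 2 ∨ k = 3)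
    (hr : IsRelaxation M M' X) : 2 ≤ X.ncard ∧ 2 ≤ (M.E \ X).ncard := by
  obtain ⟨hCE, hSE, hCS, hS5, hrk⟩ := h
  have hE := hr.rk_ground_left
  have hSC := hrk S subset_rfl
  have h1 := rk_mono (M := M) (union_subset hSE hCE)
  have h2 := rk_union_le (M := M) (U := M.E) (P := S ∪ C) (Q := M.E \ (S ∪ C))
    (by rw [union_sdiff_self]; exact subset_union_right)
  have hCfin := M.set_finite C hCE
  have h3 := rk_le_ncard (M := M) hCfin
  have h4 := rk_le_ncard (M := M) (M.ground_finite.sdiff (t := S ∪ C))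
  have h5 := ncard_sdiff_add_ncard_of_subset (union_subset hSE hCE) M.ground_finite
  have h6 := ncard_union_eq hCS.symm (M.set_finite S hSE) hCfin
  have h7 := ncard_sdiff_add_ncard_of_subset (circuitHyperplane_iff.1 hr.1).1 M.ground_finite
  omega

theorem UniformOver.exists_reduction_of_ncard_inter_le_one (h : UniformOver M k C S)
    (hk : k = 2 ∨ k = 3) (hr : IsRelaxation M M' X) (hsep : Separation M' 2 A B)
    (hS : (S ∩ A).ncard ≤ 1) :
    ∃ a ∈ M.E, (a ∉ X ∧ HasUnifMinor (Relax.delete M {a}) k 5) ∨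
      (a ∈ X ∧ HasUnifMinor (Relax.contract M {a}) k 5) := by
  have := hr.finite_right
  obtain ⟨hAB, hd, hA2, hB2, hle⟩ := hsep
  rw [hr.2.1] at hAB hle
  have hAE : A ⊆ M.E := hAB ▸ subset_union_left
  have hE := hr.rk_ground_left
  have hE' := hr.rk_ground_right
  have hX' := hr.rk_right
  have hXE := (circuitHyperplane_iff.1 hr.1).1
  have hA := hr.rk_le A
  have hB := hr.rk_le B
  by_cases hAX : Disjoint A X
  · have hXB : X ⊆ B := fun x hx =>
      (hAB.symm.subset (hXE hx)).resolve_left fun hxA => disjoint_left.1 hAX hxA hx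
    have := rk_mono (M := M') hXB
    obtain ⟨a, ha, h'⟩ := h.exists_delete (by omega) hA2 (by omega) hS
    exact ⟨a, hAE ha, .inl ⟨disjoint_left.1 hAX ha, h'⟩⟩
  by_cases hAX' : A ⊆ X
  · have hAfin := M.set_finite A hAE
    have hi : M'.Indep A := ((hr.2.2 X).2 (.inr rfl)).indep.subset hAX'
    have hrA := rk_eq_of_indep hi
    obtain ⟨a, ha, h'⟩ := h.exists_contract (by omega) hAE hA2 (fun a ha b hb hab => by
      have h1 := hr.rk_le (M.E \ {a, b})
      have h2 := rk_union_le (M := M') (U := M.E \ {a, b}) (P := (A \ {a}) \ {b}) (Q := B)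
        (by grind)
      have h3 := rk_le_ncard (M := M') (hAfin.sdiff (t := {a})).sdiff (X := (A \ {a}) \ {b})
      have h4 := ncard_sdiff_singleton_add_one ha hAfin
      have h5 := ncard_sdiff_singleton_add_one (s := A \ {a}) ⟨hb, hab.symm⟩ hAfin.sdiff
      omega) hS
    exact ⟨a, hAE ha, .inr ⟨hAX' ha, h'⟩⟩
  obtain ⟨t, htA, htX⟩ := not_disjoint_iff.1 hAX
  obtain ⟨a, haA, haX⟩ := not_subset.1 hAX'
  have hXB : (X ∩ B).Nonempty := by
    by_contra hemp
    have hXA : X ⊆ A := fun x hx =>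
      (hAB.symm.subset (hXE hx)).resolve_right fun hxB => hemp ⟨x, hx, hxB⟩
    have h1 := rk_mono (M := M') hXA
    have h2 := h.2.2.2.2 (S ∩ B) inter_subset_left
    have h3 := rk_union_le (M := M) (U := S ∩ B ∪ C) (P := B) (Q := C)
      (union_subset_union_left _ inter_subset_right)
    have h4 := ncard_union_le (S ∩ A) (S ∩ B)
    rw [← inter_union_distrib_left, hAB, inter_eq_self_of_subset_left h.2.1] at h4
    have h5 := h.2.2.2.1
    omega
  have hC := circuit_iff_isCircuit.1 hr.1.1
  have hXfin := M.set_finite X hXE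
  rcases h.exists_reduction_of_crossing hk hAB hd (by omega) hXE (fun x hx => by
      have h1 := rk_eq_of_indep (hC.sdiff_singleton_indep hx)
      have h2 := ncard_sdiff_singleton_add_one hx hXfin
      have h3 := rk_le_ncard (M := M) hXfin
      have h4 := mt (indep_iff_rk hXfin).2 hC.not_indep
      have h5 := rk_mono (M := M) (X := X \ {x}) (Y := X) sdiff_subset
      omega) (fun Y hY => rk_eq_of_indep (hC.ssubset_indep hY)) htX htA haX haA hXB hS with h' | h'
  · exact ⟨a, hAE haA, .inl ⟨haX, h'⟩⟩
  · exact ⟨t, hAE htA, .inr ⟨htX, h'⟩⟩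

/-- If the relaxation of `M` at `X` has a 2-separation, then an element outside `X` can be
deleted, or one inside `X` contracted, keeping a `{U_{2,5}, U_{3,5}}`-minor. -/
theorem IsRelaxation.exists_reduction (hr : IsRelaxation M M' X) (hsep : Separation M' 2 A B)
    (h : HasU25U35Minor M) :
    ∃ a ∈ M.E, (a ∉ X ∧ HasU25U35Minor (Relax.delete M {a})) ∨
      (a ∈ X ∧ HasU25U35Minor (Relax.contract M {a})) := by
  obtain ⟨k, hk, h⟩ := hasU25U35Minor_iff.1 h
  obtain ⟨C, S, h⟩ := h.exists_uniformOver
  have key : ∃ a ∈ M.E, (a ∉ X ∧ HasUnifMinor (Relax.delete M {a}) k 5) ∨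
      (a ∈ X ∧ HasUnifMinor (Relax.contract M {a}) k 5) := by
    obtain ⟨hAB, hd, hA2, hB2, hle⟩ := id hsep
    have hA := hr.rk_le A
    have hB := hr.rk_le B
    have hE := hr.rk_ground_left
    have hE' := hr.rk_ground_right
    rw [hr.2.1] at hAB hle
    rcases h.ncard_inter_le_one hk hAB hd (by omega) with hS | hS
    · exact h.exists_reduction_of_ncard_inter_le_one hk hr hsep hS
    · refine h.exists_reduction_of_ncard_inter_le_one hk hr (A := B) (B := A) ?_ hS
      exact ⟨by rw [union_comm, hAB, hr.2.1], hd.symm, hB2, hA2, by rw [hr.2.1]; omega⟩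
  obtain ⟨a, ha, h'⟩ := key
  exact ⟨a, ha, h'.imp (.imp_right fun h => hasU25U35Minor_iff.2 ⟨k, hk, h⟩)
    (.imp_right fun h => hasU25U35Minor_iff.2 ⟨k, hk, h⟩)⟩

theorem IsRelaxation.two_le_ncard (hr : IsRelaxation M M' X) (h : HasU25U35Minor M) :
    2 ≤ X.ncard ∧ 2 ≤ (M.E \ X).ncard := by
  obtain ⟨k, hk, h⟩ := hasU25U35Minor_iff.1 h
  obtain ⟨C, S, h⟩ := h.exists_uniformOver
  exact h.two_le_ncard hk hr

/-- Deleting an element outside `X`, or contracting one inside `X`, is compatible with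
relaxing `X`. -/
theorem IsRelaxation.exists_minor (hr : IsRelaxation M M' X) (h : HasU25U35Minor M)
    (hrep : Representable M' F) (he : e ∈ M.E)
    (h' : (e ∉ X ∧ HasU25U35Minor (Relax.delete M {e})) ∨
      (e ∈ X ∧ HasU25U35Minor (Relax.contract M {e}))) :
    ∃ (N N' : Matroid α) (Y : Set α), N ≤m M ∧ e ∉ N.E ∧ IsRelaxation N N' Y ∧
      Representable N' F ∧ HasU25U35Minor N := by
  obtain ⟨hX2, hX2'⟩ := hr.two_le_ncard h
  rcases h' with ⟨heX, h'⟩ | ⟨heX, h'⟩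
  · obtain ⟨f, hf, hfe⟩ := exists_ne_of_one_lt_ncard hX2' e
    exact ⟨Relax.delete M {e}, _, X, ⟨∅, {e}, by rw [contract_empty]; rfl⟩, fun h => h.2 rfl,
      isRelaxation_delete hr ⟨he, heX⟩ hf hfe.symm, hrep.delete {e}, h'⟩
  · obtain ⟨f, hf, hfe⟩ := exists_ne_of_one_lt_ncard hX2 e
    have hnl : M'.IsNonloop e := indep_singleton.1
      (((hr.2.2 X).2 (.inr rfl)).indep.subset (singleton_subset_iff.2 heX))
    exact ⟨Relax.contract M {e}, _, X \ {e}, ⟨{e}, ∅, by rw [delete_empty]; rfl⟩,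
      fun h => h.2 rfl,
      isRelaxation_contract hr heX hf hfe.symm, hrep.contract hnl, h'⟩

/-- A matroid with a `{U_{2,5}, U_{3,5}}`-minor and a representable relaxation has a minor that
is connected and has a 3-connected representable relaxation. -/
theorem IsRelaxation.exists_threeConnected {M M' : Matroid α} {X : Set α} (hfin : M.E.Finite)
    (hr : IsRelaxation M M' X) (h : HasU25U35Minor M) (hrep : Representable M' F) :
    ∃ N, N ≤m M ∧ Connected N ∧ HasU25U35Minor N ∧ ∃ (Y : Set α) (N' : Matroid α),
      IsRelaxation N N' Y ∧ ThreeConnected N' ∧ Representable N' F := by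
  induction hn : M.E.ncard using Nat.strong_induction_on generalizing M M' X with
  | _ n ih =>
    subst hn
    have : M.Finite := ⟨hfin⟩
    by_cases hsep : ∀ A B, ¬ Separation M' 2 A B
    · obtain ⟨hX2, hX2'⟩ := hr.two_le_ncard h
      exact ⟨M, .refl, hr.connected_left hsep hX2 hX2', h, X, M', hr,
        ⟨hr.connected_right, hsep⟩, hrep⟩
    push Not at hsep
    obtain ⟨A, B, hsep⟩ := hsep
    obtain ⟨a, ha, h'⟩ := hr.exists_reduction hsep h
    obtain ⟨N, N', Y, hNM, haN, hrN, hrepN, hN⟩ := hr.exists_minor h hrep ha h'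
    have hss : N.E ⊂ M.E := hNM.subset.ssubset_of_mem_notMem ha haN
    obtain ⟨P, hPN, hP⟩ := ih _ (ncard_lt_ncard hss hfin) (hfin.subset hNM.subset) hrN hN hrepN rfl
    exact ⟨P, hPN.trans hNM, hP⟩

end Fragile

end Relax

/-- Let `M` be a connected GF(4)-representable (finite) matroid that has a
`{U_{2,5}, U_{3,5}}`-minor and a circuit-hyperplane `X` such that the relaxation `M'` of `M`
at `X` is 3-connected and GF(4)-representable. Suppose `M` has no proper minor `M₀` such that
`M₀` is connected, has a `{U_{2,5}, U_{3,5}}`-minor, and has a circuit-hyperplane whose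
relaxation is 3-connected and GF(4)-representable. Then `M` is `{U_{2,5}, U_{3,5}}`-fragile. -/
theorem statement7 {α : Type*} (M M' : Matroid α) (X : Set α)
    (hfin : M.E.Finite)
    (hconn : Relax.Connected M)
    (hrep : Relax.Representable M Relax.GF4)
    (hminor : Relax.HasU25U35Minor M)
    (hrel : Relax.IsRelaxation M M' X)
    (h3c : Relax.ThreeConnected M')
    (hrep' : Relax.Representable M' Relax.GF4)
    (hmin : ∀ M₀ : Matroid α, Relax.MinorOf M₀ M → M₀ ≠ M →
      ¬ (Relax.Connected M₀ ∧ Relax.HasU25U35Minor M₀ ∧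
          ∃ (Y : Set α) (M₀' : Matroid α), Relax.IsRelaxation M₀ M₀' Y ∧
            Relax.ThreeConnected M₀' ∧ Relax.Representable M₀' Relax.GF4)) :
    Relax.FragileU25U35 M := by
  have : M.Finite := ⟨hfin⟩
  refine ⟨hminor, fun e he ⟨hdel, hcon⟩ => ?_⟩
  have h' : (e ∉ X ∧ Relax.HasU25U35Minor (Relax.delete M {e})) ∨
      (e ∈ X ∧ Relax.HasU25U35Minor (Relax.contract M {e})) := by
    by_cases heX : e ∈ X
    exacts [.inr ⟨heX, hcon⟩, .inl ⟨heX, hdel⟩]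
  obtain ⟨N, N', Y, hNM, heN, hrN, hrepN, hN⟩ := hrel.exists_minor hminor hrep' he h'
  obtain ⟨P, hPN, hP⟩ := hrN.exists_threeConnected (hfin.subset hNM.subset) hN hrepN
  exact hmin P (Relax.minorOf_iff_isMinor.2 (hPN.trans hNM))
    (fun h => heN (hPN.subset (h ▸ he))) hP
end

section
/- Let M and M' be GF(4)-representable matroids such that M is connected, M' is 3-connected, and M' is obtained from M by relaxing a circuit-hyperplane X. If M' has a {U_{2,5}, U_{3,5}}-minor, then M has no {U_{2,5}, U_{3,5}}-minor. -/
open Matroid Set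
open scoped Classical

section LinearAlgebra

variable {α F V : Type*} [Field F] [AddCommGroup V] [Module F V]

lemma linearIndependent_sum_smul_iff_det {n : ℕ} {w h : Fin n → V}
    (hw : LinearIndependent F w) (A : Matrix (Fin n) (Fin n) F)
    (hA : ∀ a, h a = ∑ b, A a b • w b) :
    LinearIndependent F h ↔ A.det ≠ 0 := by
  have h1 : h = (Fintype.linearCombination F w) ∘ A.row := by
    funext a
    simp [hA a, Fintype.linearCombination_apply]
  have h2 : LinearMap.ker (Fintype.linearCombination F w) = ⊥ := by
    rw [LinearMap.ker_eq_bot]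
    exact hw.fintypeLinearCombination_injective
  rw [h1, LinearMap.linearIndependent_iff _ h2, Matrix.linearIndependent_rows_iff_isUnit,
    Matrix.isUnit_iff_isUnit_det, isUnit_iff_ne_zero]

lemma mkQ_sum_smul {S : Finset α} {φ : α → V} {n : ℕ} {p : Fin n → α}
    (hp : Function.Injective p) (hpS : ∀ b, p b ∈ S) (c : α → F) :
    (Submodule.span F (φ '' (↑S \ range p))).mkQ (∑ z ∈ S, c z • φ z) =
      ∑ b, c (p b) • (Submodule.span F (φ '' (↑S \ range p))).mkQ (φ (p b)) := by
  rw [map_sum]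
  have h1 : Finset.univ.image p ⊆ S := by
    intro z hz
    obtain ⟨b, -, rfl⟩ := Finset.mem_image.1 hz
    exact hpS b
  rw [← Finset.sum_subset h1, Finset.sum_image (fun x _ y _ hxy => hp hxy)]
  · simp
  · intro z hzS hz
    rw [Submodule.mkQ_apply, Submodule.Quotient.mk_eq_zero]
    refine Submodule.smul_mem _ _ (Submodule.subset_span ⟨z, ⟨hzS, ?_⟩, rfl⟩)
    rintro ⟨b, rfl⟩
    exact hz (Finset.mem_image_of_mem _ (Finset.mem_univ _))

lemma linearIndepOn_union_range_iff {K : Set α} {φ : α → V} {n : ℕ} {q : Fin n → α}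
    (hK : LinearIndepOn F φ K) (hq : Function.Injective q) (hqK : ∀ a, q a ∉ K) :
    LinearIndepOn F φ (K ∪ range q) ↔
      LinearIndependent F (fun a => (Submodule.span F (φ '' K)).mkQ (φ (q a))) := by
  have hd : Disjoint K (range q) := by
    rw [Set.disjoint_right]
    rintro _ ⟨a, rfl⟩
    exact hqK a
  rw [← hK.quotient_iff_union hd, linearIndepOn_range_iff hq]
  rfl

/-- Pivoting on a basis `S` of a represented matroid. -/
lemma linearIndepOn_swap_iff_det {S : Finset α} {φ : α → V} (hS : LinearIndepOn F φ (S : Set α))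
    {n : ℕ} {p q : Fin n → α} (hp : Function.Injective p) (hpS : ∀ b, p b ∈ S)
    (hq : Function.Injective q) (hqS : ∀ a, q a ∉ S) {D : α → α → F}
    (hD : ∀ a, φ (q a) = ∑ z ∈ S, D (q a) z • φ z) :
    LinearIndepOn F φ (↑S \ range p ∪ range q) ↔
      (Matrix.of fun a b => D (q a) (p b)).det ≠ 0 := by
  have hK : LinearIndepOn F φ (↑S \ range p) := hS.mono sdiff_subset
  rw [linearIndepOn_union_range_iff hK hq (fun a h => hqS a h.1)]
  have hw : LinearIndependent F
      (fun b => (Submodule.span F (φ '' (↑S \ range p))).mkQ (φ (p b))) := by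
    rw [← linearIndepOn_union_range_iff hK hp (fun b h => h.2 ⟨b, rfl⟩)]
    refine hS.mono (union_subset sdiff_subset ?_)
    rintro _ ⟨b, rfl⟩
    exact hpS b
  refine linearIndependent_sum_smul_iff_det hw _ fun a => ?_
  rw [hD, mkQ_sum_smul hp hpS]
  rfl

/-- The matrix governing pivots on a near-basis: a first column of ones, then the differences of
the columns of `D` with its first column. -/
def diffMatrix {R : Type*} [Ring R] {m : ℕ} (D : Fin (m + 1) → Fin (m + 1) → R) :
    Matrix (Fin (m + 1)) (Fin (m + 1)) R :=
  Matrix.of fun a => Fin.cons 1 fun b => D a b.succ - D a 0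

/-- Pivoting on a set `S` which becomes a basis after replacing an element by a vector `f₀`. -/
lemma linearIndepOn_swap_iff_diffMatrix_det {S : Finset α} {φ : α → V} {f₀ : V} {l : α → F}
    (hl : ∑ z ∈ S, l z • φ z = 0)
    {m : ℕ} {p q : Fin (m + 1) → α} (hp : Function.Injective p) (hpS : ∀ b, p b ∈ S)
    (hq : Function.Injective q) (hqS : ∀ a, q a ∉ S) (hlp : ∀ b, l (p b) ≠ 0)
    (hS : LinearIndepOn F φ (↑S \ {p 0}))
    (hf₀ : f₀ ∉ Submodule.span F (φ '' (↑S \ {p 0})))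
    {t : Fin (m + 1) → F} (ht : ∀ a, t a ≠ 0) {C D : α → α → F}
    (hC : ∀ a, φ (q a) = t a • (f₀ + ∑ z ∈ S, C (q a) z • φ z))
    (hCD : ∀ a b, C (q a) (p b) = D (q a) (p b) * l (p b)) :
    LinearIndepOn F φ (↑S \ range p ∪ range q) ↔
      (diffMatrix fun a b => D (q a) (p b)).det ≠ 0 := by
  have hKs : (↑S \ range p : Set α) ⊆ ↑S \ {p 0} := by
    rintro z ⟨hz, hz'⟩
    exact ⟨hz, fun h => hz' ⟨0, h.symm⟩⟩
  have hK : LinearIndepOn F φ (↑S \ range p) := hS.mono hKs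
  rw [linearIndepOn_union_range_iff hK hq (fun a h => hqS a h.1)]
  set Q := (Submodule.span F (φ '' (↑S \ range p))).mkQ with hQ
  have hw0 : LinearIndependent F (fun b : Fin m => Q (φ (p b.succ))) := by
    rw [hQ, ← linearIndepOn_union_range_iff (q := fun b : Fin m => p b.succ) hK
      (hp.comp (Fin.succ_injective _)) (fun b h => h.2 ⟨_, rfl⟩)]
    refine hS.mono (union_subset hKs ?_)
    rintro _ ⟨b, rfl⟩
    exact ⟨hpS _, fun h => Fin.succ_ne_zero b (hp h)⟩
  have hw1 : LinearIndependent F (fun b : Fin m => l (p b.succ) • Q (φ (p b.succ))) :=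
    hw0.units_smul (fun b => Units.mk0 _ (hlp b.succ))
  have hw : LinearIndependent F
      (Fin.cons (Q f₀) (fun b : Fin m => l (p b.succ) • Q (φ (p b.succ))) : Fin (m + 1) → _) := by
    rw [linearIndependent_finCons]
    refine ⟨hw1, fun hmem => hf₀ ?_⟩
    have h1 : Submodule.span F (range fun b : Fin m => l (p b.succ) • Q (φ (p b.succ))) ≤
        (Submodule.span F (φ '' (↑S \ {p 0}))).map Q := by
      rw [Submodule.span_le]
      rintro _ ⟨b, rfl⟩
      refine Submodule.smul_mem _ _ (Submodule.mem_map_of_mem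
        (Submodule.subset_span ⟨_, ⟨hpS _, ?_⟩, rfl⟩))
      exact fun h => Fin.succ_ne_zero b (hp h)
    have h2 := h1 hmem
    rw [← Submodule.mem_comap, hQ, Submodule.comap_map_mkQ] at h2
    rwa [sup_eq_right.2 (Submodule.span_mono (image_mono hKs))] at h2
  have hsum := mkQ_sum_smul (φ := φ) hp hpS l
  rw [hl, map_zero, Fin.sum_univ_succ] at hsum
  have h3 := linearIndependent_sum_smul_iff_det hw (diffMatrix fun a b => D (q a) (p b))
    (h := fun a => Q f₀ + ∑ b, D (q a) (p b) • l (p b) • Q (φ (p b))) (fun a => by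
      rw [Fin.sum_univ_succ, Fin.sum_univ_succ]
      have h4 : l (p 0) • Q (φ (p 0)) = - ∑ b : Fin m, l (p b.succ) • Q (φ (p b.succ)) :=
        eq_neg_of_add_eq_zero_left hsum.symm
      rw [h4]
      simp only [diffMatrix, Matrix.of_apply, Fin.cons_zero, Fin.cons_succ, one_smul, sub_smul,
        Finset.sum_sub_distrib, smul_neg, Finset.smul_sum]
      abel)
  rw [← h3, ← LinearIndependent.units_smul_iff (fun a => Q f₀ + _)
    (fun a => Units.mk0 (t a) (ht a))]
  have h5 : (fun a => Q (φ (q a))) = (fun a => Units.mk0 (t a) (ht a)) •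
      fun a => Q f₀ + ∑ b, D (q a) (p b) • l (p b) • Q (φ (p b)) := by
    funext a
    rw [hC a, map_smul, map_add, hQ, mkQ_sum_smul hp hpS]
    simp [hCD, mul_smul, Units.smul_def]
  rw [h5]

end LinearAlgebra

section Representation

variable {α F V : Type*} [Field F] [AddCommGroup V] [Module F V]

/-- `φ` is a representation of the matroid `N` over `F`. -/
def IsRep (F : Type*) [Field F] {V : Type*} [AddCommGroup V] [Module F V]
    (N : Matroid α) (φ : α → V) : Prop :=
  ∀ S ⊆ N.E, (N.Indep S ↔ LinearIndepOn F φ S)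

lemma ncard_sdiff_range_union_range {Z : Set α} (hZ : Z.Finite) {n : ℕ} {p q : Fin n → α}
    (hp : Function.Injective p) (hpZ : ∀ b, p b ∈ Z) (hq : Function.Injective q)
    (hqZ : ∀ a, q a ∉ Z) : (Z \ range p ∪ range q).ncard = Z.ncard := by
  have hpZ' : range p ⊆ Z := by
    rintro _ ⟨b, rfl⟩
    exact hpZ b
  have h1 : (range p).ncard = (range q).ncard := by
    rw [← image_univ, ← image_univ, ncard_image_of_injective _ hp, ncard_image_of_injective _ hq]
  rw [ncard_union_eq _ (hZ.subset sdiff_subset) (finite_range q), ← h1,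
    ncard_sdiff_add_ncard_of_subset hpZ' hZ]
  rw [Set.disjoint_right]
  rintro _ ⟨a, rfl⟩ h
  exact hqZ a h.1

lemma ncard_insert_sdiff_singleton {Z : Set α} (hZ : Z.Finite) {i j : α} (hj : j ∈ Z)
    (hi : i ∉ Z) : (insert i (Z \ {j})).ncard = Z.ncard := by
  rw [ncard_insert_of_notMem (fun h => hi h.1) (hZ.subset sdiff_subset),
    ncard_sdiff_singleton_add_one hj hZ]

lemma Matroid.IsBase.isBase_iff_indep {N : Matroid α} (hE : N.E.Finite) {B S : Set α}
    (hB : N.IsBase B) (hS : S.ncard = B.ncard) : N.IsBase S ↔ N.Indep S := by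
  refine ⟨fun h => h.indep, fun h => ?_⟩
  obtain ⟨B', hB', hSB'⟩ := h.exists_isBase_superset
  have := hB.ncard_eq_ncard_of_isBase hB'
  rwa [eq_of_subset_of_ncard_le hSB' (by omega) (hE.subset hB'.subset_ground)]

lemma IsRep.mem_span {N : Matroid α} {φ : α → V} (hN : IsRep F N φ) {B : Set α}
    (hB : N.IsBase B) {x : α} (hx : x ∈ N.E) : φ x ∈ Submodule.span F (φ '' B) := by
  by_cases hxB : x ∈ B
  · exact Submodule.subset_span ⟨x, hxB, rfl⟩
  by_contra h
  have h1 : LinearIndepOn F φ (insert x B) :=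
    ((hN B hB.subset_ground).1 hB.indep).insert h
  rw [← hN _ (insert_subset hx hB.subset_ground)] at h1
  exact hxB (hB.mem_of_insert_indep h1)

lemma IsRep.exists_det {N : Matroid α} {φ : α → V} (hN : IsRep F N φ) (hE : N.E.Finite)
    {Z : Set α} (hZ : N.IsBase Z) :
    ∃ D : α → α → F, ∀ (n : ℕ) (p q : Fin n → α), Function.Injective p → Function.Injective q →
      (∀ b, p b ∈ Z) → (∀ a, q a ∈ N.E \ Z) →
      (N.IsBase (Z \ range p ∪ range q) ↔ (Matrix.of fun a b => D (q a) (p b)).det ≠ 0) := by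
  have hZE := hZ.subset_ground
  obtain ⟨S, rfl⟩ := (hE.subset hZE).exists_finset_coe
  have h1 : ∀ x, ∃ c : α → F, x ∈ N.E → φ x = ∑ z ∈ S, c z • φ z := by
    intro x
    by_cases hx : x ∈ N.E
    · have h2 := hN.mem_span hZ hx
      rw [Submodule.mem_span_image_finset_iff_exists_fun] at h2
      obtain ⟨c, hc⟩ := h2
      refine ⟨fun z => if hz : z ∈ S then c ⟨z, hz⟩ else 0, fun _ => ?_⟩
      rw [← hc, ← Finset.sum_coe_sort S]
      exact Finset.sum_congr rfl fun z _ => by simp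
    · exact ⟨0, fun h => absurd h hx⟩
  choose D hD using h1
  refine ⟨D, fun n p q hp hq hpZ hqZ => ?_⟩
  rw [hZ.isBase_iff_indep hE (ncard_sdiff_range_union_range S.finite_toSet hp hpZ hq
    fun a => (hqZ a).2), hN, linearIndepOn_swap_iff_det ((hN _ hZE).1 hZ.indep) hp hpZ hq
    (fun a => (hqZ a).2) fun a => hD _ (hqZ a).1]
  refine union_subset (sdiff_subset.trans hZE) ?_
  rintro _ ⟨a, rfl⟩
  exact (hqZ a).1

lemma exists_eq_smul_add_sum {φ : α → V} {S : Finset α} {x f : α}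
    (h : φ x ∈ Submodule.span F (φ '' insert f (S : Set α))) :
    ∃ (a : F) (c : α → F), φ x = a • φ f + ∑ z ∈ S, c z • φ z := by
  rw [image_insert_eq, Submodule.mem_span_insert] at h
  obtain ⟨a, v, hv, hx⟩ := h
  rw [Submodule.mem_span_image_finset_iff_exists_fun] at hv
  obtain ⟨c, hc⟩ := hv
  refine ⟨a, fun z => if hz : z ∈ S then c ⟨z, hz⟩ else 0, ?_⟩
  rw [hx, ← hc, ← Finset.sum_coe_sort S]
  exact congrArg _ (Finset.sum_congr rfl fun z _ => by simp)

lemma IsRep.exists_diffMatrix {N : Matroid α} {φ : α → V} (hN : IsRep F N φ) (hE : N.E.Finite)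
    {Z I J : Set α} (hZE : Z ⊆ N.E) (hZ : ¬ N.IsBase Z) (hJ : J ⊆ Z) (hI : I ⊆ N.E \ Z)
    {e f : α} (he : e ∈ J) (hf : f ∈ I) (h : ∀ j ∈ J, ∀ i ∈ I, N.IsBase (insert i (Z \ {j}))) :
    ∃ D : α → α → F, (∀ j, D f j = 0) ∧ (∀ i ∈ I, D i e = 0) ∧
      ∀ (m : ℕ) (p q : Fin (m + 1) → α), Function.Injective p → Function.Injective q →
      (∀ b, p b ∈ J) → (∀ a, q a ∈ I) →
      (N.IsBase (Z \ range p ∪ range q) ↔ (diffMatrix fun a b => D (q a) (p b)).det ≠ 0) := by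
  obtain ⟨S, rfl⟩ := (hE.subset hZE).exists_finset_coe
  have hI' : ∀ i ∈ I, i ∉ S := fun i hi => (hI hi).2
  have hbase : ∀ j ∈ J, ∀ i ∈ I, LinearIndepOn F φ (insert i (↑S \ {j})) := fun j hj i hi =>
    (hN _ (insert_subset (hI hi).1 (sdiff_subset.trans hZE))).1 (h j hj i hi).indep
  have hdel : ∀ j ∈ J, LinearIndepOn F φ (↑S \ {j} : Set α) := fun j hj =>
    (hbase j hj f hf).mono (subset_insert _ _)
  have hspan : ∀ j ∈ J, ∀ i ∈ I, φ i ∉ Submodule.span F (φ '' (↑S \ {j})) := fun j hj i hi =>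
    ((linearIndepOn_insert (fun hh => hI' i hi hh.1)).1 (hbase j hj i hi)).2
  have heS : φ e ∈ Submodule.span F (φ '' (↑S \ {e})) := by
    by_contra hcon
    have h1 := (hdel e he).insert hcon
    rw [insert_sdiff_singleton, insert_eq_of_mem (hJ he), ← hN _ hZE,
      ← (h e he f hf).isBase_iff_indep hE
        (ncard_insert_sdiff_singleton S.finite_toSet (hJ he) (hI' f hf)).symm] at h1
    exact hZ h1
  have hco : (↑S \ {e} : Set α) = ↑(S.erase e) := by simp
  obtain ⟨c, hc⟩ : ∃ c : α → F, φ e = ∑ z ∈ S.erase e, c z • φ z := by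
    rw [hco, Submodule.mem_span_image_finset_iff_exists_fun] at heS
    obtain ⟨c, hc⟩ := heS
    refine ⟨fun z => if hz : z ∈ S.erase e then c ⟨z, hz⟩ else 0, ?_⟩
    rw [← hc, ← Finset.sum_coe_sort (S.erase e)]
    exact Finset.sum_congr rfl fun z _ => by simp [-Finset.mem_erase]
  set l : α → F := fun z => if z = e then -1 else c z with hldef
  have hl : ∑ z ∈ S, l z • φ z = 0 := by
    rw [← Finset.add_sum_erase S _ (hJ he)]
    have h2 : ∑ z ∈ S.erase e, l z • φ z = ∑ z ∈ S.erase e, c z • φ z :=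
      Finset.sum_congr rfl fun z hz => by simp [hldef, Finset.ne_of_mem_erase hz]
    rw [h2, ← hc]
    simp [hldef]
  have hlJ : ∀ j ∈ J, l j ≠ 0 := by
    intro j hj hlj
    have h2 := hl
    rw [← Finset.add_sum_erase S _ (hJ hj), hlj, zero_smul, zero_add] at h2
    have h3 := hdel j hj
    rw [show (↑S \ {j} : Set α) = ↑(S.erase j) by simp, linearIndepOn_finset_iff] at h3
    have hne : e ≠ j := by
      rintro rfl
      simp [hldef] at hlj
    have h4 := h3 l h2 e (Finset.mem_erase.2 ⟨hne, hJ he⟩)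
    simp [hldef] at h4
  have h1 : ∀ i, ∃ (a : F) (d : α → F), a ≠ 0 ∧ d e = 0 ∧ (i = f → ∀ z, d z = 0) ∧
      (i ∈ I → φ i = a • φ f + ∑ z ∈ S, d z • φ z) := by
    intro i
    by_cases hi : i ∈ I
    · by_cases hif : i = f
      · exact ⟨1, 0, one_ne_zero, rfl, fun _ _ => rfl, fun _ => by simp [hif]⟩
      have h2 := hN.mem_span (h e he f hf) (hI hi).1
      rw [hco] at h2
      obtain ⟨a, d, had⟩ := exists_eq_smul_add_sum h2
      refine ⟨a, fun z => if z = e then 0 else d z, ?_, by simp, fun h => absurd h hif,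
        fun _ => ?_⟩
      · rintro rfl
        refine hspan e he i hi ?_
        rw [had, zero_smul, zero_add]
        refine Submodule.sum_mem _ fun z hz => Submodule.smul_mem _ _ (Submodule.subset_span
          ⟨z, ?_, rfl⟩)
        rw [hco]
        exact hz
      · rw [had, ← Finset.add_sum_erase S _ (hJ he)]
        simp only [if_true, zero_smul, zero_add]
        exact congrArg _ (Finset.sum_congr rfl fun z hz => by simp [Finset.ne_of_mem_erase hz])
    · exact ⟨1, 0, one_ne_zero, rfl, fun _ _ => rfl, fun h => absurd h hi⟩
  choose a d ha hde hdf hd using h1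
  refine ⟨fun i z => d i z / (a i * l z), by simp [hdf], by simp [hde],
    fun m p q hp hq hpJ hqI => ?_⟩
  have hqS : ∀ k, q k ∉ S := fun k => hI' _ (hqI k)
  have hpS : ∀ k, p k ∈ S := fun k => hJ (hpJ k)
  have hsub : (↑S \ range p ∪ range q : Set α) ⊆ N.E := by
    refine union_subset (sdiff_subset.trans hZE) ?_
    rintro _ ⟨k, rfl⟩
    exact (hI (hqI k)).1
  rw [(h e he f hf).isBase_iff_indep hE (by
    rw [ncard_insert_sdiff_singleton S.finite_toSet (hJ he) (hI' f hf),
      ncard_sdiff_range_union_range S.finite_toSet hp hpS hq hqS]), hN _ hsub]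
  refine linearIndepOn_swap_iff_diffMatrix_det (C := fun i z => d i z / a i)
    (D := fun i z => d i z / (a i * l z)) hl hp hpS hq hqS
    (fun b => hlJ _ (hpJ b)) (hdel _ (hpJ 0)) (hspan _ (hpJ 0) f hf) (t := fun k => a (q k))
    (fun k => ha _) (fun k => ?_) (fun k b => ?_)
  · rw [hd _ (hqI k), smul_add, Finset.smul_sum]
    refine congrArg _ (Finset.sum_congr rfl fun z _ => ?_)
    rw [smul_smul, mul_div_cancel₀ _ (ha _)]
  · have := ha (q k)
    have := hlJ _ (hpJ b)
    field_simp

end Representation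

section VectorMatroid

variable {α F V : Type*} [Field F] [AddCommGroup V] [Module F V]

lemma exists_matroid_isRep {E : Set α} (hE : E.Finite) (φ : α → V) :
    ∃ N : Matroid α, N.E = E ∧ IsRep F N φ := by
  refine ⟨(IndepMatroid.ofFinite hE (fun S => S ⊆ E ∧ LinearIndepOn F φ S)
    ⟨empty_subset _, linearIndepOn_empty _ _⟩ (fun I J hJ hIJ => ⟨hIJ.trans hJ.1, hJ.2.mono hIJ⟩)
    ?_ (fun I hI => hI.1)).matroid, rfl, fun S hS => ?_⟩
  · rintro I J ⟨hI, hIi⟩ ⟨hJ, hJi⟩ hlt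
    by_contra! hcon
    have h1 : ∀ x ∈ J, φ x ∈ Submodule.span F (φ '' I) := by
      intro x hx
      by_cases hxI : x ∈ I
      · exact Submodule.subset_span ⟨x, hxI, rfl⟩
      by_contra h
      exact hcon x hx hxI (insert_subset (hJ hx) hI) (hIi.insert h)
    have hIf := hE.subset hI
    have hJf := hE.subset hJ
    have h2 : Submodule.span F (φ '' J) ≤ Submodule.span F (φ '' I) := by
      rw [Submodule.span_le]
      rintro _ ⟨x, hx, rfl⟩
      exact h1 x hx
    have key : ∀ K : Set α, K.Finite → LinearIndepOn F φ K →
        Module.finrank F (Submodule.span F (φ '' K)) = K.ncard := by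
      intro K hK hKi
      have : Fintype K := hK.fintype
      have h3 := finrank_span_eq_card hKi
      rwa [← image_eq_range, ← Nat.card_eq_fintype_card, Nat.card_coe_set_eq] at h3
    have : FiniteDimensional F (Submodule.span F (φ '' I)) :=
      FiniteDimensional.span_of_finite F (hIf.image φ)
    have h4 := Submodule.finrank_mono h2
    rw [key I hIf hIi, key J hJf hJi] at h4
    omega
  · exact and_iff_right hS

lemma LinearIndepOn.ncard_le_finrank [FiniteDimensional F V] {φ : α → V} {S : Set α}
    (hSf : S.Finite) (hS : LinearIndepOn F φ S) : S.ncard ≤ Module.finrank F V := by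
  have : Fintype S := hSf.fintype
  have h3 := LinearIndependent.fintype_card_le_finrank hS
  rwa [← Nat.card_eq_fintype_card, Nat.card_coe_set_eq] at h3

/-- The matroid on `E` in which `X` is a circuit-hyperplane and whose remaining bases are
described by the matrix `c`. -/
lemma exists_isRep_diffMatrix {E X : Set α} (hE : E.Finite) (hXE : X ⊆ E) (hX : X.Nonempty)
    (c : α → α → F) :
    ∃ (N : Matroid α) (φ : α → X → F), N.E = E ∧ IsRep F N φ ∧ ¬ N.IsBase X ∧
      ∀ (m : ℕ) (p q : Fin (m + 1) → α), Function.Injective p → Function.Injective q →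
      (∀ b, p b ∈ X) → (∀ a, q a ∈ E \ X) →
      (N.IsBase (X \ range p ∪ range q) ↔ (diffMatrix fun a b => c (q a) (p b)).det ≠ 0) := by
  obtain ⟨S, rfl⟩ := (hE.subset hXE).exists_finset_coe
  obtain ⟨x₀, hx₀⟩ := hX
  set g : α → ↥(S : Set α) → F := fun x z =>
    if (z : α) = x₀ then 0 else if x = x₀ then -1 else if (z : α) = x then 1 else 0 with hg
  set f₀ : ↥(S : Set α) → F := fun z => if (z : α) = x₀ then 1 else 0 with hf₀
  set φ : α → ↥(S : Set α) → F := fun x =>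
    if x ∈ S then g x else f₀ + ∑ z ∈ S, c x z • g z with hφ
  have hφS : ∀ x ∈ S, φ x = g x := fun x hx => by simp [hφ, hx]
  have hcoord : ∀ (a : α → F) (z : (S : Set α)), (z : α) ≠ x₀ →
      (∑ x ∈ S, a x • φ x) z = a z - a x₀ := by
    intro a z hz
    rw [Finset.sum_apply]
    have h1 : ∀ x ∈ S, (a x • φ x) z =
        (if (z : α) = x then a x else 0) - (if x₀ = x then a x else 0) := by
      intro x hx
      rw [hφS x hx]
      by_cases h2 : x = x₀
      · subst h2
        simp [hg, hz]
      · simp [hg, hz, h2, Ne.symm h2]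
    rw [Finset.sum_congr rfl h1, Finset.sum_sub_distrib, Finset.sum_ite_eq, Finset.sum_ite_eq,
      if_pos (Finset.mem_coe.1 z.2),
      if_pos (Finset.mem_coe.1 hx₀)]
  have hcoord0 : ∀ (a : α → F), (∑ x ∈ S, a x • φ x) ⟨x₀, hx₀⟩ = 0 := by
    intro a
    rw [Finset.sum_apply]
    refine Finset.sum_eq_zero fun x hx => ?_
    rw [hφS x hx]
    simp [hg]
  have hl : ∑ x ∈ S, (1 : α → F) x • φ x = 0 := by
    funext z
    by_cases hz : (z : α) = x₀
    · have : z = ⟨x₀, hx₀⟩ := Subtype.ext hz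
      rw [this, hcoord0]
      rfl
    · rw [hcoord _ _ hz]
      simp
  have hind : ∀ x ∈ S, ∀ (a : α → F) (t : F), ∑ z ∈ S.erase x, a z • φ z = t • f₀ →
      t = 0 ∧ ∀ z ∈ S.erase x, a z = 0 := by
    intro x hx a t h
    have h1 : ∑ z ∈ S, (fun z => if z = x then 0 else a z) z • φ z = t • f₀ := by
      rw [← Finset.add_sum_erase S _ hx, ← h]
      simp only [if_true, zero_smul, zero_add]
      exact Finset.sum_congr rfl fun z hz => by simp [Finset.ne_of_mem_erase hz]
    have h2 := congrFun h1 ⟨x₀, hx₀⟩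
    rw [hcoord0] at h2
    have ht : t = 0 := by simpa [hf₀] using h2.symm
    refine ⟨ht, ?_⟩
    have h3 : ∀ z ∈ S, (if z = x then 0 else a z) = (if x₀ = x then 0 else a x₀) := by
      intro z hz
      by_cases hzx : z = x₀
      · rw [hzx]
      have h4 := congrFun h1 ⟨z, hz⟩
      rw [hcoord _ _ hzx, ht, zero_smul] at h4
      exact sub_eq_zero.1 h4
    intro z hz
    have h5 := h3 z (Finset.mem_of_mem_erase hz)
    have h6 := h3 x hx
    rw [if_neg (Finset.ne_of_mem_erase hz)] at h5
    rw [if_pos rfl] at h6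
    rw [h5, ← h6]
  have hco : ∀ x, (↑S \ {x} : Set α) = ↑(S.erase x) := fun x => by simp
  obtain ⟨N, rfl, hN⟩ := exists_matroid_isRep (F := F) hE φ
  have hrank : Module.finrank F (↥(S : Set α) → F) = (S : Set α).ncard := by
    rw [Module.finrank_fintype_fun_eq_card, ← Nat.card_eq_fintype_card, Nat.card_coe_set_eq]
  have hbase : ∀ T ⊆ N.E, T.ncard = (S : Set α).ncard → (N.IsBase T ↔ LinearIndepOn F φ T) := by
    intro T hT hTc
    rw [← hN T hT]
    refine ⟨fun h => h.indep, fun h => ?_⟩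
    obtain ⟨B, hB, hTB⟩ := h.exists_isBase_superset
    have hBf := hE.subset hB.subset_ground
    have h7 := ((hN B hB.subset_ground).1 hB.indep).ncard_le_finrank hBf
    rwa [eq_of_subset_of_ncard_le hTB (by omega) hBf]
  refine ⟨N, φ, rfl, hN, ?_, fun m p q hp hq hpX hqX => ?_⟩
  · rw [hbase _ hXE rfl, linearIndepOn_finset_iff]
    intro h
    simpa using h 1 hl x₀ hx₀
  · have hsub : (↑S \ range p ∪ range q : Set α) ⊆ N.E := by
      refine union_subset (sdiff_subset.trans hXE) ?_
      rintro _ ⟨k, rfl⟩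
      exact (hqX k).1
    rw [hbase _ hsub (ncard_sdiff_range_union_range S.finite_toSet hp hpX hq fun k => (hqX k).2)]
    refine linearIndepOn_swap_iff_diffMatrix_det (l := 1) (f₀ := f₀) (t := 1) (C := c) (D := c)
      hl hp hpX hq (fun k => (hqX k).2) (by simp) ?_ ?_ (by simp) (fun k => ?_) (by simp)
    · rw [hco, linearIndepOn_finset_iff]
      exact fun a ha => (hind _ (hpX 0) a 0 (by rw [ha, zero_smul])).2
    · rw [hco, Submodule.mem_span_image_finset_iff_exists_fun]
      rintro ⟨a, ha⟩
      have h8 := (hind _ (hpX 0)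
        (fun z => if hz : z ∈ S.erase (p 0) then a ⟨z, hz⟩ else 0) 1 (by
          rw [one_smul, ← ha, ← Finset.sum_coe_sort (S.erase (p 0))]
          exact Finset.sum_congr rfl fun z _ => by simp [-Finset.mem_erase])).1
      exact one_ne_zero h8
    · have h9 : q k ∉ S := (hqX k).2
      have h10 : φ (q k) = f₀ + ∑ z ∈ S, c (q k) z • g z := by simp [hφ, h9]
      rw [h10, Pi.one_apply, one_smul]
      exact congrArg _ (Finset.sum_congr rfl fun z hz => by rw [hφS z hz])

end VectorMatroid

section Matrices

variable {α K : Type*} [Field K]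

lemma det_ne_zero_iff_of_scaling {L : Type*} [Field L] {n : ℕ} {A : Matrix (Fin n) (Fin n) K}
    {B : Matrix (Fin n) (Fin n) L} (σ : K →+* L) {r c : Fin n → L} (hr : ∀ a, r a ≠ 0)
    (hc : ∀ b, c b ≠ 0) (h : ∀ a b, B a b = r a * c b * σ (A a b)) :
    B.det ≠ 0 ↔ A.det ≠ 0 := by
  have h1 : B = Matrix.of fun a b => r a * (Matrix.of fun a b => c b * σ.mapMatrix A a b) a b := by
    ext a b
    simp [h, mul_assoc]
  rw [h1, Matrix.det_mul_column, Matrix.det_mul_row, ← RingHom.map_det]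
  simp [Finset.prod_ne_zero_iff.2 fun a _ => hr a, Finset.prod_ne_zero_iff.2 fun a _ => hc a]

lemma diffMatrix_det_ne_zero_iff {m : ℕ} {D T : Fin (m + 1) → Fin (m + 1) → K} {κ : K}
    (hκ : κ ≠ 0) (h : ∀ a b, D a b = κ * T a b) :
    (diffMatrix D).det ≠ 0 ↔ (diffMatrix T).det ≠ 0 := by
  refine det_ne_zero_iff_of_scaling (RingHom.id K) (r := 1)
    (c := Fin.cons 1 fun _ => κ) (by simp) (fun b => ?_) (fun a b => ?_)
  · refine Fin.cases ?_ (fun b => ?_) b <;> simp [hκ]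
  · refine Fin.cases ?_ (fun b => ?_) b <;> simp [diffMatrix, h, mul_sub]

lemma eq_neg_of_ne_zmod_three {x y : ZMod 3} (hx : x ≠ 0) (hy : y ≠ 0) (h : x ≠ y) : x = -y := by
  revert x y
  decide

lemma exists_eq_mul_of_quad_iff [CharP K 2] {I J : Set α} {e f : α} (he : e ∈ J) (hf : f ∈ I)
    {D : α → α → K} {s : α → α → ZMod 3} (hDf : ∀ j, D f j = 0) (hDe : ∀ i ∈ I, D i e = 0)
    (hs : ∀ i ∈ I, ∀ j ∈ J, s i j ≠ 0)
    (h : ∀ i ∈ I, ∀ i' ∈ I, ∀ j ∈ J, ∀ j' ∈ J,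
      (D i j - D i j' - D i' j + D i' j' = 0 ↔ s i j * s i' j' = s i j' * s i' j)) :
    ∃ κ : K, κ ≠ 0 ∧ ∀ i ∈ I, ∀ j ∈ J,
      D i j = κ * if s i j * s f e = s i e * s f j then 0 else 1 := by
  have hsfe := hs f hf e he
  have h0 : ∀ i ∈ I, ∀ j ∈ J, (D i j = 0 ↔ s i j * s f e = s i e * s f j) := by
    intro i hi j hj
    have := h i hi f hf j hj e he
    rwa [hDf, hDf, hDe i hi, sub_zero, sub_zero, add_zero] at this
  have hneg : ∀ i ∈ I, ∀ j ∈ J, D i j ≠ 0 → s i j * s f e = - (s i e * s f j) := by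
    intro i hi j hj hD
    exact eq_neg_of_ne_zmod_three (mul_ne_zero (hs i hi j hj) hsfe)
      (mul_ne_zero (hs i hi e he) (hs f hf j hj)) (fun hh => hD ((h0 i hi j hj).2 hh))
  have hrow : ∀ i ∈ I, ∀ j ∈ J, ∀ j' ∈ J, D i j ≠ 0 → D i j' ≠ 0 → D i j = D i j' := by
    intro i hi j hj j' hj' h1 h2
    have h3 := h i hi f hf j hj j' hj'
    rw [hDf, hDf, sub_zero, add_zero, sub_eq_zero] at h3
    refine h3.2 (mul_right_cancel₀ hsfe ?_)
    linear_combination s f j' * hneg i hi j hj h1 - s f j * hneg i hi j' hj' h2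
  have hcol : ∀ i ∈ I, ∀ i' ∈ I, ∀ j ∈ J, D i j ≠ 0 → D i' j ≠ 0 → D i j = D i' j := by
    intro i hi i' hi' j hj h1 h2
    have h3 := h i hi i' hi' j hj e he
    rw [hDe i hi, hDe i' hi', sub_zero, add_zero, sub_eq_zero] at h3
    refine h3.2 (mul_right_cancel₀ hsfe ?_)
    linear_combination s i' e * hneg i hi j hj h1 - s i e * hneg i' hi' j hj h2
  by_cases hall : ∀ i ∈ I, ∀ j ∈ J, D i j = 0
  · refine ⟨1, one_ne_zero, fun i hi j hj => ?_⟩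
    rw [if_pos ((h0 i hi j hj).1 (hall i hi j hj)), hall i hi j hj, mul_zero]
  push Not at hall
  obtain ⟨i', hi', j', hj', h2⟩ := hall
  refine ⟨D i' j', h2, fun i hi j hj => ?_⟩
  by_cases h1 : D i j = 0
  · rw [if_pos ((h0 i hi j hj).1 h1), h1, mul_zero]
  rw [if_neg (fun hh => h1 ((h0 i hi j hj).2 hh)), mul_one]
  by_cases h3 : D i j' = 0
  · by_cases h4 : D i' j = 0
    · have h5 := h i hi i' hi' j hj j' hj'
      rw [h3, h4, sub_zero, sub_zero] at h5
      rw [← sub_eq_zero, CharTwo.sub_eq_add, h5]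
      refine mul_right_cancel₀ hsfe (mul_right_cancel₀ hsfe ?_)
      linear_combination (s i' j' * s f e) * hneg i hi j hj h1
        - s i e * s f j * hneg i' hi' j' hj' h2 - (s i' j * s f e) * (h0 i hi j' hj').1 h3
        - s i e * s f j' * (h0 i' hi' j hj).1 h4
    · exact (hrow i' hi' j' hj' j hj h2 h4 ▸ hcol i hi i' hi' j hj h1 h4)
  · exact (hrow i hi j hj j' hj' h1 h3).trans (hcol i hi i' hi' j' hj' h3 h2)

lemma eq_or_eq_sq (h3 : ∀ z : K, z ≠ 0 → z ^ 3 = 1) {x y : K} (hx : x ≠ 0) (hx1 : x ≠ 1)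
    (hy : y ≠ 0) (hy1 : y ≠ 1) : y = x ∨ y = x ^ 2 := by
  have key : ∀ z : K, z ≠ 0 → z ≠ 1 → z ^ 2 + z + 1 = 0 := by
    intro z hz hz1
    have := h3 z hz
    have h1 : (z - 1) * (z ^ 2 + z + 1) = 0 := by linear_combination this
    exact (mul_eq_zero.1 h1).resolve_left (sub_ne_zero.2 hz1)
  have h1 := key x hx hx1
  have h2 := key y hy hy1
  have h4 : (y - x) * (y - x ^ 2) = 0 := by
    linear_combination h2 + (x - 1 - y) * h1
  rcases mul_eq_zero.1 h4 with h | h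
  · exact Or.inl (sub_eq_zero.1 h)
  · exact Or.inr (sub_eq_zero.1 h)

lemma eq_of_eq_iff (h3 : ∀ z : K, z ≠ 0 → z ^ 3 = 1) {x y y' : K} (hx : x ≠ 0) (hx1 : x ≠ 1)
    (hy : y ≠ 0) (hy1 : y ≠ 1) (hy' : y' ≠ 0) (hy1' : y' ≠ 1)
    (h : x = y ↔ x = y') : y' = y := by
  rcases eq_or_eq_sq h3 hx hx1 hy hy1 with h1 | h1
  · rw [h1, ← h.1 h1.symm]
  · rcases eq_or_eq_sq h3 hx hx1 hy' hy1' with h2 | h2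
    · rw [h2, h.2 h2.symm]
    · rw [h1, h2]

lemma eq_of_mul_eq_one_iff (h3 : ∀ z : K, z ≠ 0 → z ^ 3 = 1) {x y y' : K} (hx : x ≠ 0)
    (hx1 : x ≠ 1) (hy : y ≠ 0) (hy1 : y ≠ 1) (hy' : y' ≠ 0) (hy1' : y' ≠ 1)
    (h : x * y = 1 ↔ x * y' = 1) : y' = y := by
  have hx3 := h3 x hx
  have hsq : x * x ^ 2 = 1 := by linear_combination hx3
  rcases eq_or_eq_sq h3 hx hx1 hy hy1 with h1 | h1
  · rcases eq_or_eq_sq h3 hx hx1 hy' hy1' with h2 | h2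
    · rw [h1, h2]
    · exact mul_left_cancel₀ hx ((h2 ▸ hsq).trans (h.2 (h2 ▸ hsq)).symm)
  · exact mul_left_cancel₀ hx ((h.1 (h1 ▸ hsq)).trans (h1 ▸ hsq).symm)

/-- Two normalised matrices over `GF(4)` with no zero entry and the same vanishing `2 × 2`
minors agree up to the Frobenius automorphism. -/
lemma eq_or_eq_sq_of_quad_iff (h3 : ∀ z : K, z ≠ 0 → z ^ 3 = 1) {I J : Set α} {e f : α}
    (he : e ∈ J) (hf : f ∈ I) {u v : α → α → K} (hu : ∀ i ∈ I, ∀ j ∈ J, u i j ≠ 0)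
    (hv : ∀ i ∈ I, ∀ j ∈ J, v i j ≠ 0) (hue : ∀ i ∈ I, u i e = 1) (huf : ∀ j ∈ J, u f j = 1)
    (hve : ∀ i ∈ I, v i e = 1) (hvf : ∀ j ∈ J, v f j = 1)
    (h : ∀ i ∈ I, ∀ i' ∈ I, ∀ j ∈ J, ∀ j' ∈ J,
      (u i j * u i' j' = u i j' * u i' j ↔ v i j * v i' j' = v i j' * v i' j)) :
    (∀ i ∈ I, ∀ j ∈ J, v i j = u i j) ∨ (∀ i ∈ I, ∀ j ∈ J, v i j = u i j ^ 2) := by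
  have h1 : ∀ i ∈ I, ∀ j ∈ J, (u i j = 1 ↔ v i j = 1) := by
    intro i hi j hj
    have := h i hi f hf j hj e he
    rwa [hue i hi, hue f hf, huf j hj, hve i hi, hve f hf, hvf j hj, mul_one, mul_one, mul_one]
      at this
  have hrow : ∀ i ∈ I, ∀ j ∈ J, ∀ j' ∈ J, u i j ≠ 1 → u i j' ≠ 1 → v i j = u i j →
      v i j' = u i j' := by
    intro i hi j hj j' hj' hn hn' heq
    have h2 := h i hi f hf j hj j' hj'
    rw [huf j hj, huf j' hj', hvf j hj, hvf j' hj', mul_one, mul_one, mul_one, mul_one, heq] at h2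
    exact eq_of_eq_iff h3 (hu i hi j hj) hn (hu i hi j' hj') hn' (hv i hi j' hj')
      (fun hh => hn' ((h1 i hi j' hj').2 hh)) h2
  have hcol : ∀ i ∈ I, ∀ i' ∈ I, ∀ j ∈ J, u i j ≠ 1 → u i' j ≠ 1 → v i j = u i j →
      v i' j = u i' j := by
    intro i hi i' hi' j hj hn hn' heq
    have h2 := h i hi i' hi' j hj e he
    rw [hue i hi, hue i' hi', hve i hi, hve i' hi', mul_one, one_mul, mul_one, one_mul, heq] at h2
    exact eq_of_eq_iff h3 (hu i hi j hj) hn (hu i' hi' j hj) hn' (hv i' hi' j hj)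
      (fun hh => hn' ((h1 i' hi' j hj).2 hh)) h2
  have hcell : ∀ i ∈ I, ∀ i' ∈ I, ∀ j ∈ J, ∀ j' ∈ J, u i j ≠ 1 → u i' j' ≠ 1 → v i j = u i j →
      v i' j' = u i' j' := by
    intro i hi i' hi' j hj j' hj' hn hn' heq
    by_cases ha : u i j' = 1
    · by_cases hb : u i' j = 1
      · have h2 := h i hi i' hi' j hj j' hj'
        rw [ha, hb, (h1 i hi j' hj').1 ha, (h1 i' hi' j hj).1 hb, mul_one, heq] at h2
        exact eq_of_mul_eq_one_iff h3 (hu i hi j hj) hn (hu i' hi' j' hj') hn' (hv i' hi' j' hj')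
          (fun hh => hn' ((h1 i' hi' j' hj').2 hh)) h2
      · exact hrow i' hi' j hj j' hj' hb hn' (hcol i hi i' hi' j hj hn hb heq)
    · exact hcol i hi i' hi' j' hj' ha hn' (hrow i hi j hj j' hj' hn ha heq)
  by_cases hall : ∀ i ∈ I, ∀ j ∈ J, v i j = u i j
  · exact Or.inl hall
  refine Or.inr fun i hi j hj => ?_
  push Not at hall
  obtain ⟨i', hi', j', hj', h2⟩ := hall
  have hn' : u i' j' ≠ 1 := fun hh => h2 (((h1 i' hi' j' hj').1 hh).trans hh.symm)
  by_cases hn : u i j = 1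
  · rw [hn, (h1 i hi j hj).1 hn, one_pow]
  · have h4 : v i j ≠ u i j := fun hh => h2 (hcell i hi i' hi' j hj j' hj' hn hn' hh)
    exact (eq_or_eq_sq h3 (hu i hi j hj) hn (hv i hi j hj)
      (fun hh => hn ((h1 i hi j hj).2 hh))).resolve_left h4

lemma exists_scaling_of_quad_iff [CharP K 2] (h3 : ∀ z : K, z ≠ 0 → z ^ 3 = 1) {I J : Set α}
    {e f : α} (he : e ∈ J) (hf : f ∈ I) {C D : α → α → K} (hC : ∀ i ∈ I, ∀ j ∈ J, C i j ≠ 0)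
    (hD : ∀ i ∈ I, ∀ j ∈ J, D i j ≠ 0)
    (h : ∀ i ∈ I, ∀ i' ∈ I, ∀ j ∈ J, ∀ j' ∈ J,
      (C i j * C i' j' = C i j' * C i' j ↔ D i j * D i' j' = D i j' * D i' j)) :
    ∃ (σ : K →+* K) (r c : α → K), (∀ i ∈ I, r i ≠ 0) ∧ (∀ j ∈ J, c j ≠ 0) ∧
      ∀ i ∈ I, ∀ j ∈ J, D i j = r i * c j * σ (C i j) := by
  have norm : ∀ A : α → α → K, (∀ i ∈ I, ∀ j ∈ J, A i j ≠ 0) → ∀ i ∈ I, ∀ i' ∈ I, ∀ j ∈ J,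
      ∀ j' ∈ J, (A i j * A f e / (A i e * A f j) * (A i' j' * A f e / (A i' e * A f j')) =
        A i j' * A f e / (A i e * A f j') * (A i' j * A f e / (A i' e * A f j)) ↔
        A i j * A i' j' = A i j' * A i' j) := by
    intro A hA i hi i' hi' j hj j' hj'
    have h4 := hA f hf e he
    have h5 := hA i hi e he
    have h6 := hA i' hi' e he
    have h7 := hA f hf j hj
    have h8 := hA f hf j' hj'
    field_simp
  have key : ∃ σ : K →+* K, ∀ i ∈ I, ∀ j ∈ J,
      D i j * D f e / (D i e * D f j) = σ (C i j * C f e / (C i e * C f j)) := by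
    rcases eq_or_eq_sq_of_quad_iff h3 he hf
      (u := fun i j => C i j * C f e / (C i e * C f j))
      (v := fun i j => D i j * D f e / (D i e * D f j))
      (fun i hi j hj => div_ne_zero (mul_ne_zero (hC i hi j hj) (hC f hf e he))
        (mul_ne_zero (hC i hi e he) (hC f hf j hj)))
      (fun i hi j hj => div_ne_zero (mul_ne_zero (hD i hi j hj) (hD f hf e he))
        (mul_ne_zero (hD i hi e he) (hD f hf j hj)))
      (fun i hi => div_self (mul_ne_zero (hC i hi e he) (hC f hf e he)))
      (fun j hj => by
        rw [mul_comm (C f j)]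
        exact div_self (mul_ne_zero (hC f hf e he) (hC f hf j hj)))
      (fun i hi => div_self (mul_ne_zero (hD i hi e he) (hD f hf e he)))
      (fun j hj => by
        rw [mul_comm (D f j)]
        exact div_self (mul_ne_zero (hD f hf e he) (hD f hf j hj)))
      (fun i hi i' hi' j hj j' hj' => by
        rw [norm C hC i hi i' hi' j hj j' hj', norm D hD i hi i' hi' j hj j' hj']
        exact h i hi i' hi' j hj j' hj') with h4 | h4
    · exact ⟨RingHom.id K, h4⟩
    · exact ⟨frobenius K 2, h4⟩
  obtain ⟨σ, hσ⟩ := key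
  have hσ0 : ∀ {z : K}, z ≠ 0 → σ z ≠ 0 := fun hz => (map_ne_zero σ).2 hz
  refine ⟨σ, fun i => D i e / σ (C i e), fun j => D f j / σ (C f j) * (σ (C f e) / D f e),
    fun i hi => div_ne_zero (hD i hi e he) (hσ0 (hC i hi e he)),
    fun j hj => mul_ne_zero (div_ne_zero (hD f hf j hj) (hσ0 (hC f hf j hj)))
      (div_ne_zero (hσ0 (hC f hf e he)) (hD f hf e he)), fun i hi j hj => ?_⟩
  have h4 := hσ i hi j hj
  rw [map_div₀, map_mul, map_mul] at h4
  have h5 := hD f hf e he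
  have h6 := hD i hi e he
  have h7 := hD f hf j hj
  have h8 := hσ0 (hC i hi e he)
  have h9 := hσ0 (hC f hf j hj)
  field_simp at h4 ⊢
  linear_combination h4

end Matrices

section Pivots

variable {α K V V' : Type*} [Field K] [AddCommGroup V] [Module K V] [AddCommGroup V'] [Module K V']

lemma injective_vec_two {a b : α} (h : a ≠ b) : Function.Injective ![a, b] := by
  intro x y hxy
  fin_cases x <;> fin_cases y <;> simp_all

lemma range_vec_two (a b : α) : range ![a, b] = {a, b} := by
  rw [Matrix.range_cons, Matrix.range_cons, Matrix.range_empty, union_empty, ← insert_eq]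

lemma IsRep.exists_matrix {N : Matroid α} {φ : α → V} (hN : IsRep K N φ) (hE : N.E.Finite)
    {Z : Set α} (hZ : N.IsBase Z) :
    ∃ D : α → α → K,
      (∀ j ∈ Z, ∀ i ∈ N.E \ Z, (N.IsBase (insert i (Z \ {j})) ↔ D i j ≠ 0)) ∧
      (∀ j ∈ Z, ∀ j' ∈ Z, ∀ i ∈ N.E \ Z, ∀ i' ∈ N.E \ Z, j ≠ j' → i ≠ i' →
        (N.IsBase (Z \ {j, j'} ∪ {i, i'}) ↔ D i j * D i' j' ≠ D i j' * D i' j)) ∧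
      ∀ (n : ℕ) (p q : Fin n → α), Function.Injective p → Function.Injective q →
      (∀ b, p b ∈ Z) → (∀ a, q a ∈ N.E \ Z) →
      (N.IsBase (Z \ range p ∪ range q) ↔ (Matrix.of fun a b => D (q a) (p b)).det ≠ 0) := by
  obtain ⟨D, hD⟩ := hN.exists_det hE hZ
  refine ⟨D, fun j hj i hi => ?_, fun j hj j' hj' i hi i' hi' hjj hii => ?_, hD⟩
  · have := hD 1 ![j] ![i] (Function.injective_of_subsingleton _)
      (Function.injective_of_subsingleton _) (by simpa using hj) (by simpa using hi)
    simpa [Matrix.range_cons, Matrix.range_empty] using this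
  · have := hD 2 ![j, j'] ![i, i'] (injective_vec_two hjj) (injective_vec_two hii)
      (by simp [Fin.forall_fin_two, hj, hj']) (by
        rw [Fin.forall_fin_two]
        exact ⟨hi, hi'⟩)
    rw [Matrix.det_fin_two, range_vec_two, range_vec_two] at this
    simpa [sub_eq_zero] using this

lemma diffMatrix_det_two {D : Fin 2 → Fin 2 → K} :
    (diffMatrix D).det = D 0 0 - D 0 1 - D 1 0 + D 1 1 := by
  rw [Matrix.det_fin_two]
  simp only [diffMatrix, Matrix.of_apply, Fin.cons_zero, Fin.cons_one]
  simp only [Fin.succ_zero_eq_one]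
  ring

lemma isBase_pair_iff_of_diffMatrix {N : Matroid α} {Z I J : Set α} {D : α → α → K}
    (hD : ∀ (m : ℕ) (p q : Fin (m + 1) → α), Function.Injective p → Function.Injective q →
      (∀ b, p b ∈ J) → (∀ a, q a ∈ I) →
      (N.IsBase (Z \ range p ∪ range q) ↔ (diffMatrix fun a b => D (q a) (p b)).det ≠ 0))
    {j j' i i' : α} (hj : j ∈ J) (hj' : j' ∈ J) (hi : i ∈ I) (hi' : i' ∈ I) (hjj : j ≠ j')
    (hii : i ≠ i') :
    N.IsBase (Z \ {j, j'} ∪ {i, i'}) ↔ D i j - D i j' - D i' j + D i' j' ≠ 0 := by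
  have := hD 1 ![j, j'] ![i, i'] (injective_vec_two hjj) (injective_vec_two hii)
      (by simp [Fin.forall_fin_two, hj, hj']) (by simp [Fin.forall_fin_two, hi, hi'])
  rw [diffMatrix_det_two, range_vec_two, range_vec_two] at this
  simpa using this

lemma IsRep.isBase_iff_of_isBase [CharP K 2] (h3 : ∀ z : K, z ≠ 0 → z ^ 3 = 1)
    {N N' : Matroid α} {φ : α → V} {φ' : α → V'} (hN : IsRep K N φ) (hN' : IsRep K N' φ')
    (hE : N.E.Finite) (hE' : N'.E = N.E) {Z I J : Set α} (hZ : N.IsBase Z) (hZ' : N'.IsBase Z)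
    (hJ : J ⊆ Z) (hI : I ⊆ N.E \ Z)
    (h1 : ∀ j ∈ J, ∀ i ∈ I, N.IsBase (insert i (Z \ {j})))
    (h1' : ∀ j ∈ J, ∀ i ∈ I, N'.IsBase (insert i (Z \ {j})))
    (h2 : ∀ j ∈ J, ∀ j' ∈ J, ∀ i ∈ I, ∀ i' ∈ I, j ≠ j' → i ≠ i' →
      (N.IsBase (Z \ {j, j'} ∪ {i, i'}) ↔ N'.IsBase (Z \ {j, j'} ∪ {i, i'})))
    {m : ℕ} {p q : Fin (m + 1) → α} (hp : Function.Injective p) (hq : Function.Injective q)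
    (hpJ : ∀ b, p b ∈ J) (hqI : ∀ a, q a ∈ I) :
    N.IsBase (Z \ range p ∪ range q) ↔ N'.IsBase (Z \ range p ∪ range q) := by
  obtain ⟨C, hC1, hC2, hC⟩ := hN.exists_matrix hE hZ
  obtain ⟨D, hD1, hD2, hD⟩ := hN'.exists_matrix (hE' ▸ hE) hZ'
  rw [hE'] at hD1 hD2 hD
  obtain ⟨σ, r, c, hr, hc, h4⟩ := exists_scaling_of_quad_iff h3 (hpJ 0) (hqI 0)
    (fun i hi j hj => (hC1 j (hJ hj) i (hI hi)).1 (h1 j hj i hi))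
    (fun i hi j hj => (hD1 j (hJ hj) i (hI hi)).1 (h1' j hj i hi))
    (fun i hi i' hi' j hj j' hj' => by
      by_cases hii : i = i'
      · subst hii
        simp only [mul_comm]
      by_cases hjj : j = j'
      · subst hjj
        simp
      rw [← not_iff_not, ← ne_eq, ← ne_eq,
        ← hC2 j (hJ hj) j' (hJ hj') i (hI hi) i' (hI hi') hjj hii,
        ← hD2 j (hJ hj) j' (hJ hj') i (hI hi) i' (hI hi') hjj hii]
      exact h2 j hj j' hj' i hi i' hi' hjj hii)
  rw [hC _ p q hp hq (fun b => hJ (hpJ b)) (fun a => hI (hqI a)),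
    hD _ p q hp hq (fun b => hJ (hpJ b)) (fun a => hI (hqI a))]
  exact (det_ne_zero_iff_of_scaling σ (fun a => hr _ (hqI a)) (fun b => hc _ (hpJ b))
    fun a b => h4 _ (hqI a) _ (hpJ b)).symm

lemma IsRep.isBase_iff_diffMatrix_of_sign [CharP K 2] {N : Matroid α} {φ : α → V}
    (hN : IsRep K N φ) (hE : N.E.Finite) {Z I J : Set α} (hZE : Z ⊆ N.E) (hZ : ¬ N.IsBase Z)
    (hJ : J ⊆ Z) (hI : I ⊆ N.E \ Z) {e f : α} (he : e ∈ J) (hf : f ∈ I)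
    (h1 : ∀ j ∈ J, ∀ i ∈ I, N.IsBase (insert i (Z \ {j})))
    {s : α → α → ZMod 3} (hs : ∀ i ∈ I, ∀ j ∈ J, s i j ≠ 0)
    (h2 : ∀ j ∈ J, ∀ j' ∈ J, ∀ i ∈ I, ∀ i' ∈ I, j ≠ j' → i ≠ i' →
      (N.IsBase (Z \ {j, j'} ∪ {i, i'}) ↔ s i j * s i' j' ≠ s i j' * s i' j))
    {m : ℕ} {p q : Fin (m + 1) → α} (hp : Function.Injective p) (hq : Function.Injective q)
    (hpJ : ∀ b, p b ∈ J) (hqI : ∀ a, q a ∈ I) :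
    N.IsBase (Z \ range p ∪ range q) ↔ (diffMatrix fun a b =>
      if s (q a) (p b) * s f e = s (q a) e * s f (p b) then (0 : K) else 1).det ≠ 0 := by
  obtain ⟨D, hDf, hDe, hD⟩ := hN.exists_diffMatrix hE hZE hZ hJ hI he hf h1
  obtain ⟨κ, hκ, h4⟩ := exists_eq_mul_of_quad_iff he hf hDf hDe hs
    (fun i hi i' hi' j hj j' hj' => by
    by_cases hii : i = i'
    · subst hii
      simp [mul_comm]
    by_cases hjj : j = j'
    · subst hjj
      simp
    rw [← not_iff_not, ← ne_eq, ← ne_eq, ← h2 j hj j' hj' i hi i' hi' hjj hii,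
      isBase_pair_iff_of_diffMatrix hD hj hj' hi hi' hjj hii])
  rw [hD _ p q hp hq hpJ hqI]
  exact diffMatrix_det_ne_zero_iff hκ fun a b => h4 _ (hqI a) _ (hpJ b)

lemma IsRep.isBase_iff_of_not_isBase [CharP K 2] {U : Type*} [AddCommGroup U] [Module (ZMod 3) U]
    {N N' T : Matroid α} {φ : α → V} {φ' : α → V'} {ψ : α → U} (hN : IsRep K N φ)
    (hN' : IsRep K N' φ') (hT : IsRep (ZMod 3) T ψ) (hE : N.E.Finite) (hE' : N'.E = N.E)
    (hTE : T.E = N.E) {Z I J : Set α} (hZ : ¬ N.IsBase Z) (hZ' : ¬ N'.IsBase Z)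
    (hTZ : T.IsBase Z) (hJ : J ⊆ Z) (hI : I ⊆ N.E \ Z)
    (h1 : ∀ j ∈ J, ∀ i ∈ I, N.IsBase (insert i (Z \ {j})))
    (h1' : ∀ j ∈ J, ∀ i ∈ I, N'.IsBase (insert i (Z \ {j})))
    (hT1 : ∀ j ∈ J, ∀ i ∈ I, T.IsBase (insert i (Z \ {j})))
    (h2 : ∀ j ∈ J, ∀ j' ∈ J, ∀ i ∈ I, ∀ i' ∈ I, j ≠ j' → i ≠ i' →
      (N.IsBase (Z \ {j, j'} ∪ {i, i'}) ↔ T.IsBase (Z \ {j, j'} ∪ {i, i'})))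
    (h2' : ∀ j ∈ J, ∀ j' ∈ J, ∀ i ∈ I, ∀ i' ∈ I, j ≠ j' → i ≠ i' →
      (N'.IsBase (Z \ {j, j'} ∪ {i, i'}) ↔ T.IsBase (Z \ {j, j'} ∪ {i, i'})))
    {m : ℕ} {p q : Fin (m + 1) → α} (hp : Function.Injective p) (hq : Function.Injective q)
    (hpJ : ∀ b, p b ∈ J) (hqI : ∀ a, q a ∈ I) :
    N.IsBase (Z \ range p ∪ range q) ↔ N'.IsBase (Z \ range p ∪ range q) := by
  have hZE : Z ⊆ N.E := hTE ▸ hTZ.subset_ground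
  obtain ⟨s, hs1, hs2, -⟩ := hT.exists_matrix (hTE ▸ hE) hTZ
  rw [hTE] at hs1 hs2
  have hs : ∀ i ∈ I, ∀ j ∈ J, s i j ≠ 0 := fun i hi j hj =>
    (hs1 j (hJ hj) i (hI hi)).1 (hT1 j hj i hi)
  rw [hN.isBase_iff_diffMatrix_of_sign hE hZE hZ hJ hI (hpJ 0) (hqI 0) h1 hs
      (fun j hj j' hj' i hi i' hi' hjj hii => (h2 j hj j' hj' i hi i' hi' hjj hii).trans
        (hs2 j (hJ hj) j' (hJ hj') i (hI hi) i' (hI hi') hjj hii)) hp hq hpJ hqI,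
    hN'.isBase_iff_diffMatrix_of_sign (hE' ▸ hE) (hE' ▸ hZE) hZ' hJ (hE' ▸ hI) (hpJ 0) (hqI 0)
      h1' hs (fun j hj j' hj' i hi i' hi' hjj hii => (h2' j hj j' hj' i hi i' hi' hjj hii).trans
        (hs2 j (hJ hj) j' (hJ hj') i (hI hi) i' (hI hi') hjj hii)) hp hq hpJ hqI]

end Pivots

section Exchange

variable {α : Type*}

lemma exists_fin_enum {J : Set α} (hJ : J.Finite) {n : ℕ} (hn : J.ncard = n) :
    ∃ p : Fin n → α, Function.Injective p ∧ range p = J := by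
  have := hJ.to_subtype
  let e : J ≃ Fin n := Finite.equivFinOfCardEq (by rw [Nat.card_coe_set_eq, hn])
  refine ⟨fun a => e.symm a, Subtype.val_injective.comp e.symm.injective, ?_⟩
  rw [show (fun a => ((e.symm a : J) : α)) = Subtype.val ∘ e.symm from rfl, range_comp,
    e.symm.surjective.range_eq, image_univ, Subtype.range_coe]

/-- If two matroids disagree on a set but agree on all the relevant exchanges, then every such
exchange is a base. -/
lemma isBase_insert_sdiff_singleton_of_agree {N₁ N₂ : Matroid α} (hE : N₁.E.Finite)
    (hE₂ : N₂.E = N₁.E) {X S : Set α}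
    (hX : ∀ x ∈ X, ∀ y ∈ N₁.E \ X, N₁.IsBase (insert y (X \ {x})))
    (hS : N₁.IsBase S) (hS₂ : ¬ N₂.IsBase S) (hJ : (S \ X).Nontrivial) (hI : (X \ S).Nontrivial)
    (hag : ∀ j ∈ S \ X, ∀ i ∈ X \ S,
      (N₁.IsBase (insert i (S \ {j})) ↔ N₂.IsBase (insert i (S \ {j}))))
    {i j : α} (hj : j ∈ S \ X) (hi : i ∈ X \ S) : N₁.IsBase (insert i (S \ {j})) := by
  have hSE := hS.subset_ground
  have hSf := hE.subset hSE
  obtain ⟨j₁, hj₁, h₁⟩ : ∃ j₁ ∈ S \ X, N₁.IsBase (insert i (S \ {j₁})) := by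
    obtain ⟨i', hi', hii⟩ := hI.exists_ne i
    have hB := hX i' hi'.1 j ⟨hSE hj.1, hj.2⟩
    have hind : N₁.Indep (insert i (S ∩ X)) := by
      refine hB.indep.subset ?_
      rintro z (rfl | hz)
      · exact Or.inr ⟨hi.1, fun h => hii h.symm⟩
      · refine Or.inr ⟨hz.2, ?_⟩
        rintro rfl
        exact hi'.2 hz.1
    obtain ⟨B', hB', h1, h2⟩ := hind.exists_isBase_subset_union_isBase hS
    have hsub : B' ⊆ insert i S := by
      refine h2.trans ?_
      rintro z ((rfl | hz) | hz)
      · exact Or.inl rfl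
      · exact Or.inr hz.1
      · exact Or.inr hz
    have h3 : ¬ S ⊆ B' := fun h3 => by
      have := hS.eq_of_subset_isBase hB' h3
      exact hi.2 (this ▸ h1 (mem_insert _ _))
    obtain ⟨j₁, hj₁, hj₁'⟩ := not_subset.1 h3
    refine ⟨j₁, ⟨hj₁, fun h => hj₁' (h1 (Or.inr ⟨hj₁, h⟩))⟩, ?_⟩
    have h4 : B' ⊆ insert i (S \ {j₁}) := by
      intro z hz
      rcases hsub hz with rfl | hz'
      · exact Or.inl rfl
      · refine Or.inr ⟨hz', ?_⟩
        rintro rfl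
        exact hj₁' hz
    rwa [← eq_of_subset_of_ncard_le h4 (by
      rw [ncard_insert_sdiff_singleton hSf hj₁ hi.2, hS.ncard_eq_ncard_of_isBase hB'])
      ((hSf.subset sdiff_subset).insert _)]
  obtain ⟨i₁, hi₁, h₂⟩ : ∃ i₁ ∈ X \ S, N₁.IsBase (insert i₁ (S \ {j})) := by
    obtain ⟨j', hj', hjj⟩ := hJ.exists_ne j
    have hB := hX i hi.1 j' ⟨hSE hj'.1, hj'.2⟩
    obtain ⟨y, hy, h⟩ := hS.exchange hB (e := j) ⟨hj.1, by
      rintro (h | h)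
      · exact hjj h.symm
      · exact hj.2 h.1⟩
    refine ⟨y, ⟨?_, hy.2⟩, h⟩
    rcases hy.1 with rfl | h'
    · exact absurd hj'.1 hy.2
    · exact h'.1
  rw [hag j hj i hi]
  rw [hag _ hj₁ i hi] at h₁
  rw [hag j hj _ hi₁] at h₂
  have hcard := ncard_insert_sdiff_singleton hSf hj.1 hi₁.2
  have hE' : N₂.E.Finite := hE₂ ▸ hE
  have hSd : ¬ N₂.Indep S := by
    rwa [← h₂.isBase_iff_indep hE' hcard.symm]
  rw [h₂.isBase_iff_indep hE' (by
    rw [hcard, ncard_insert_sdiff_singleton hSf hj.1 hi.2])]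
  have hcl : ∀ a ∈ S, N₂.Indep (S \ {a}) → N₂.closure (S \ {a}) = N₂.closure S := by
    intro a ha hind
    have : a ∈ N₂.closure (S \ {a}) := by
      by_contra hcon
      rw [hind.notMem_closure_iff_of_notMem (fun h => h.2 rfl) (hE₂ ▸ hSE ha),
        insert_sdiff_singleton, insert_eq_of_mem ha] at hcon
      exact hSd hcon
    rw [← closure_insert_eq_of_mem_closure this, insert_sdiff_singleton, insert_eq_of_mem ha]
  have hd := h₂.indep.subset (subset_insert _ _)
  have hd₁ := h₁.indep.subset (subset_insert _ _)
  have hiE : i ∈ N₂.E := h₁.subset_ground (mem_insert _ _)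
  rw [← hd.notMem_closure_iff_of_notMem (fun h => hi.2 h.1) hiE, hcl _ hj.1 hd, ← hcl _ hj₁.1 hd₁,
    hd₁.notMem_closure_iff_of_notMem (fun h => hi.2 h.1) hiE]
  exact h₁.indep

end Exchange

section Relaxation

variable {α K V V' U : Type*} [Field K] [AddCommGroup V] [Module K V] [AddCommGroup V']
  [Module K V'] [AddCommGroup U] [Module (ZMod 3) U]

/-- A matroid `M` over a field of size four, whose relaxation `M'` is also representable, agrees
with a ternary matroid `T` as soon as they agree on exchanges of at most two elements. -/
lemma isBase_iff_of_relaxation [CharP K 2] (h3 : ∀ z : K, z ≠ 0 → z ^ 3 = 1)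
    {M M' T : Matroid α} {φ : α → V} {φ' : α → V'} {ψ : α → U} (hM : IsRep K M φ)
    (hM' : IsRep K M' φ') (hT : IsRep (ZMod 3) T ψ) (hE : M.E.Finite) (hE' : M'.E = M.E)
    (hTE : T.E = M.E) {X : Set α} (hXE : X ⊆ M.E)
    (hrel : ∀ B, (M'.IsBase B ↔ M.IsBase B ∨ B = X)) (hMX : ¬ M.IsBase X) (hTX : ¬ T.IsBase X)
    (hM1 : ∀ x ∈ X, ∀ y ∈ M.E \ X, M.IsBase (insert y (X \ {x})))
    (hT1 : ∀ x ∈ X, ∀ y ∈ M.E \ X, T.IsBase (insert y (X \ {x})))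
    (h2 : ∀ x ∈ X, ∀ x' ∈ X, ∀ y ∈ M.E \ X, ∀ y' ∈ M.E \ X, x ≠ x' → y ≠ y' →
      (M.IsBase (X \ {x, x'} ∪ {y, y'}) ↔ T.IsBase (X \ {x, x'} ∪ {y, y'})))
    (k : ℕ) : ∀ S ⊆ M.E, S.ncard = X.ncard → (S \ X).ncard = k →
      (M.IsBase S ↔ T.IsBase S) := by
  induction k using Nat.strong_induction_on with
  | _ k ih =>
  intro S hSE hSX hk
  have hXf := hE.subset hXE
  have hSf := hE.subset hSE
  have hk' : (X \ S).ncard = k := by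
    rw [← hk, (ncard_eq_ncard_iff_ncard_sdiff_eq_ncard_sdiff hSf hXf).1 hSX]
  have hSeq : S = X \ (X \ S) ∪ (S \ X) := by
    ext z
    simp only [mem_union, mem_sdiff]
    tauto
  obtain rfl | rfl | rfl | hk3 : k = 0 ∨ k = 1 ∨ k = 2 ∨ 3 ≤ k := by omega
  · rw [ncard_eq_zero (hSf.subset sdiff_subset), sdiff_eq_empty] at hk
    rw [eq_of_subset_of_ncard_le hk hSX.ge hXf]
    exact iff_of_false hMX hTX
  · obtain ⟨y, hy⟩ := ncard_eq_one.1 hk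
    obtain ⟨x, hx⟩ := ncard_eq_one.1 hk'
    have hx' : x ∈ X \ S := hx ▸ mem_singleton x
    have hy' : y ∈ S \ X := hy ▸ mem_singleton y
    rw [hSeq, hx, hy, union_singleton]
    exact iff_of_true (hM1 x hx'.1 y ⟨hSE hy'.1, hy'.2⟩) (hT1 x hx'.1 y ⟨hSE hy'.1, hy'.2⟩)
  · obtain ⟨y, y', hyy, hy⟩ := ncard_eq_two.1 hk
    obtain ⟨x, x', hxx, hx⟩ := ncard_eq_two.1 hk'
    have hx1 : x ∈ X \ S := hx ▸ mem_insert _ _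
    have hx2 : x' ∈ X \ S := hx ▸ mem_insert_of_mem _ rfl
    have hy1 : y ∈ S \ X := hy ▸ mem_insert _ _
    have hy2 : y' ∈ S \ X := hy ▸ mem_insert_of_mem _ rfl
    rw [hSeq, hx, hy]
    exact h2 x hx1.1 x' hx2.1 y ⟨hSE hy1.1, hy1.2⟩ y' ⟨hSE hy2.1, hy2.2⟩ hxx hyy
  have hag : ∀ P ⊆ S \ X, ∀ Q ⊆ X \ S, P.ncard = Q.ncard → 0 < P.ncard → P.ncard < k →
      (M.IsBase (S \ P ∪ Q) ↔ T.IsBase (S \ P ∪ Q)) ∧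
      (M.IsBase (S \ P ∪ Q) ↔ M'.IsBase (S \ P ∪ Q)) := by
    intro P hP Q hQ hPQ hP0 hPk
    have hdiff : (S \ P ∪ Q) \ X = (S \ X) \ P := by
      ext z
      have := @hQ z
      simp only [mem_union, mem_sdiff] at this ⊢
      tauto
    have hdc : ((S \ P ∪ Q) \ X).ncard = k - P.ncard := by
      rw [hdiff, ncard_sdiff hP (hSf.subset (hP.trans sdiff_subset)), hk]
    constructor
    · refine ih (k - P.ncard) (by omega) _
        (union_subset (sdiff_subset.trans hSE) ((hQ.trans sdiff_subset).trans hXE)) ?_ hdc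
      rw [ncard_union_eq (disjoint_left.2 fun z hz hz' => (hQ hz').2 hz.1)
        (hSf.subset sdiff_subset) (hXf.subset (hQ.trans sdiff_subset)),
        ncard_sdiff (hP.trans sdiff_subset) (hSf.subset (hP.trans sdiff_subset)), hPQ, hSX]
      have := ncard_le_ncard (hQ.trans sdiff_subset) hXf
      omega
    · rw [hrel, or_iff_left]
      intro h
      rw [h, Set.sdiff_self, ncard_empty] at hdc
      omega
  have hag1 : ∀ j ∈ S \ X, ∀ i ∈ X \ S,
      (M.IsBase (insert i (S \ {j})) ↔ T.IsBase (insert i (S \ {j}))) ∧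
      (M.IsBase (insert i (S \ {j})) ↔ M'.IsBase (insert i (S \ {j}))) := by
    intro j hj i hi
    rw [← union_singleton]
    exact hag {j} (singleton_subset_iff.2 hj) {i} (singleton_subset_iff.2 hi) (by simp) (by simp)
      (by rw [ncard_singleton]; omega)
  have hag2 : ∀ j ∈ S \ X, ∀ j' ∈ S \ X, ∀ i ∈ X \ S, ∀ i' ∈ X \ S, j ≠ j' → i ≠ i' →
      (M.IsBase (S \ {j, j'} ∪ {i, i'}) ↔ T.IsBase (S \ {j, j'} ∪ {i, i'})) ∧
      (M.IsBase (S \ {j, j'} ∪ {i, i'}) ↔ M'.IsBase (S \ {j, j'} ∪ {i, i'})) := by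
    intro j hj j' hj' i hi i' hi' hjj hii
    exact hag _ (pair_subset hj hj') _ (pair_subset hi hi')
      (by rw [ncard_pair hjj, ncard_pair hii]) (by rw [ncard_pair hjj]; omega)
      (by rw [ncard_pair hjj]; omega)
  obtain ⟨m, rfl⟩ : ∃ m, k = m + 1 := ⟨k - 1, by omega⟩
  obtain ⟨p, hp, hpS⟩ := exists_fin_enum (hSf.subset sdiff_subset) hk
  obtain ⟨q, hq, hqX⟩ := exists_fin_enum (hXf.subset sdiff_subset) hk'
  have hpJ : ∀ b, p b ∈ S \ X := fun b => hpS ▸ mem_range_self b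
  have hqI : ∀ a, q a ∈ X \ S := fun a => hqX ▸ mem_range_self a
  have hswap : S \ range p ∪ range q = X := by
    rw [hpS, hqX]
    ext z
    simp only [mem_union, mem_sdiff]
    tauto
  have hI : X \ S ⊆ M.E \ S := sdiff_subset_sdiff_left hXE
  have hX' : M'.IsBase X := (hrel X).2 (Or.inr rfl)
  have hSne : S ≠ X := by
    rintro rfl
    simp at hk
  have hJn : (S \ X).Nontrivial :=
    (one_lt_ncard_iff_nontrivial_and_finite.1 (by omega)).1
  have hIn : (X \ S).Nontrivial :=
    (one_lt_ncard_iff_nontrivial_and_finite.1 (by omega)).1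
  refine ⟨fun hS => ?_, fun hS => ?_⟩ <;> by_contra hS'
  · have hadj := fun j hj i hi => isBase_insert_sdiff_singleton_of_agree hE hTE hM1 hS hS' hJn hIn
      (fun j hj i hi => (hag1 j hj i hi).1) (i := i) (j := j) hj hi
    have := hM.isBase_iff_of_isBase h3 hM' hE hE' hS ((hrel S).2 (Or.inl hS)) sdiff_subset hI hadj
      (fun j hj i hi => (hag1 j hj i hi).2.1 (hadj j hj i hi))
      (fun j hj j' hj' i hi i' hi' hjj hii => (hag2 j hj j' hj' i hi i' hi' hjj hii).2)
      hp hq hpJ hqI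
    rw [hswap] at this
    exact hMX (this.2 hX')
  · have hadj := fun j hj i hi => isBase_insert_sdiff_singleton_of_agree (hTE ▸ hE) hTE.symm
      (by rwa [hTE]) hS hS' hJn hIn
      (fun j hj i hi => (hag1 j hj i hi).1.symm) (i := i) (j := j) hj hi
    have hadjM := fun j hj i hi => (hag1 j hj i hi).1.2 (hadj j hj i hi)
    have := hM.isBase_iff_of_not_isBase hM' hT hE hE' hTE hS'
      (by rw [hrel, not_or]; exact ⟨hS', hSne⟩) hS sdiff_subset hI hadjM
      (fun j hj i hi => (hag1 j hj i hi).2.1 (hadjM j hj i hi)) hadj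
      (fun j hj j' hj' i hi i' hi' hjj hii => (hag2 j hj j' hj' i hi i' hi' hjj hii).1)
      (fun j hj j' hj' i hi i' hi' hjj hii => (hag2 j hj j' hj' i hi i' hi' hjj hii).2.symm.trans
        (hag2 j hj j' hj' i hi i' hi' hjj hii).1)
      hp hq hpJ hqI
    rw [hswap] at this
    exact hMX (this.2 hX')

end Relaxation

section FieldOfSizeFour

variable {K : Type*} [Field K]

lemma pow_three_eq_one_of_card (hK : Nat.card K = 4) {z : K} (hz : z ≠ 0) : z ^ 3 = 1 := by
  have : Finite K := Nat.finite_of_card_ne_zero (by omega)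
  have := Fintype.ofFinite K
  rw [Nat.card_eq_fintype_card] at hK
  simpa [hK] using FiniteField.pow_card_sub_one_eq_one z hz

lemma exists_log_of_card (hK : Nat.card K = 4) :
    ∃ l : K → ZMod 3, ∀ u v u' v' : K, u ≠ 0 → v ≠ 0 → u' ≠ 0 → v' ≠ 0 →
      (u * v = u' * v' ↔ l u + l v = l u' + l v') := by
  have : Finite K := Nat.finite_of_card_ne_zero (by omega)
  have : Fact (Nat.Prime 3) := ⟨Nat.prime_three⟩
  let e : Kˣ ≃* Multiplicative (ZMod 3) :=
    mulEquivOfPrimeCardEq (p := 3) (by rw [Nat.card_units, hK])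
      (by rw [Nat.card_eq_of_bijective _ Multiplicative.toAdd.bijective, Nat.card_zmod])
  refine ⟨fun u => if h : u = 0 then 0 else Multiplicative.toAdd (e (Units.mk0 u h)), ?_⟩
  intro u v u' v' hu hv hu' hv'
  simp only [dif_neg hu, dif_neg hv, dif_neg hu', dif_neg hv']
  rw [← toAdd_mul, ← toAdd_mul, ← map_mul, ← map_mul, Multiplicative.toAdd.injective.eq_iff,
    e.injective.eq_iff, Units.ext_iff]
  rfl

end FieldOfSizeFour

section Ternary

variable {α K V V' : Type*} [Field K] [AddCommGroup V] [Module K V] [AddCommGroup V']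
  [Module K V']

lemma exists_isRep_zmod_three_of_relaxation [CharP K 2] (hK : Nat.card K = 4)
    {M M' : Matroid α} {φ : α → V} {φ' : α → V'} (hM : IsRep K M φ) (hM' : IsRep K M' φ')
    (hE : M.E.Finite) (hE' : M'.E = M.E) {X : Set α} (hX : X.Nonempty) (hXE : X ⊂ M.E)
    (hrel : ∀ B, (M'.IsBase B ↔ M.IsBase B ∨ B = X)) (hMX : ¬ M.IsBase X)
    (hM1 : ∀ x ∈ X, ∀ y ∈ M.E \ X, M.IsBase (insert y (X \ {x}))) :
    ∃ ψ : α → X → ZMod 3, IsRep (ZMod 3) M ψ := by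
  have hXE' := hXE.subset
  have hXf := hE.subset hXE'
  have hX' : M'.IsBase X := (hrel X).2 (Or.inr rfl)
  obtain ⟨l, hl⟩ := exists_log_of_card hK
  obtain ⟨D, hD1, hD2, -⟩ := hM'.exists_matrix (hE' ▸ hE) hX'
  rw [hE'] at hD1 hD2
  have hne : ∀ x ∈ X, ∀ y ∈ M.E \ X, D y x ≠ 0 := fun x hx y hy =>
    (hD1 x hx y hy).1 ((hrel _).2 (Or.inl (hM1 x hx y hy)))
  obtain ⟨T, ψ, hTE, hT, hTX, hTD⟩ := exists_isRep_diffMatrix hE hXE' hX fun y x => l (D y x)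
  have hT1 : ∀ x ∈ X, ∀ y ∈ M.E \ X, T.IsBase (insert y (X \ {x})) := by
    intro x hx y hy
    have := hTD 0 ![x] ![y] (Function.injective_of_subsingleton (α := Fin 1) _)
      (Function.injective_of_subsingleton (α := Fin 1) _) (by simpa using hx) (by simpa using hy)
    simpa [Matrix.range_cons, Matrix.range_empty, diffMatrix] using this
  have hcl : ∀ S ⊆ M.E, S.ncard = X.ncard → (M.IsBase S ↔ T.IsBase S) := by
    refine fun S hSE hSX => isBase_iff_of_relaxation (fun z => pow_three_eq_one_of_card hK) hM hM'
      hT hE hE' hTE hXE' hrel hMX hTX hM1 hT1 (fun x hx x' hx' y hy y' hy' hxx hyy => ?_) _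
      S hSE hSX rfl
    rw [isBase_pair_iff_of_diffMatrix (N := T) (D := fun y x => l (D y x)) hTD hx hx' hy hy'
      hxx hyy]
    have h4 : X \ {x, x'} ∪ {y, y'} ≠ X := fun h => hy.2 (h ▸ Or.inr (mem_insert _ _))
    rw [← or_iff_left_of_imp (fun h => absurd h h4 :
      X \ {x, x'} ∪ {y, y'} = X → M.IsBase (X \ {x, x'} ∪ {y, y'})), ← hrel,
      hD2 x hx x' hx' y hy y' hy' hxx hyy, ne_eq, ne_eq,
      hl _ _ _ _ (hne x hx y hy) (hne x' hx' y' hy') (hne x' hx' y hy) (hne x hx y' hy'),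
      ← sub_eq_zero]
    ring_nf
  obtain ⟨y, hy⟩ := exists_of_ssubset hXE
  obtain ⟨x, hx⟩ := hX
  have hcM : ∀ B, M.IsBase B → B.ncard = X.ncard := fun B hB => by
    rw [hB.ncard_eq_ncard_of_isBase (hM1 x hx y hy), ncard_insert_sdiff_singleton hXf hx hy.2]
  have hcT : ∀ B, T.IsBase B → B.ncard = X.ncard := fun B hB => by
    rw [hB.ncard_eq_ncard_of_isBase (hT1 x hx y hy), ncard_insert_sdiff_singleton hXf hx hy.2]
  have hMT : M = T := by
    refine Matroid.ext_isBase hTE.symm fun B hB => ⟨fun h => ?_, fun h => ?_⟩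
    · exact (hcl B hB (hcM B h)).1 h
    · exact (hcl B hB (hcT B h)).2 h
  exact ⟨ψ, hMT ▸ hT⟩

end Ternary

namespace Relax

variable {α : Type*} {M M' : Matroid α} {X : Set α}

lemma CircuitHyperplane.not_isBase (h : CircuitHyperplane M X) : ¬ M.IsBase X :=
  fun hB => h.1.1.not_indep hB.indep

lemma CircuitHyperplane.nonempty (h : CircuitHyperplane M X) : X.Nonempty := h.1.1.nonempty

lemma CircuitHyperplane.ssubset_ground (h : CircuitHyperplane M X) : X ⊂ M.E :=
  h.1.1.subset_ground.ssubset_of_ne h.2.2.1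

lemma CircuitHyperplane.isBase_insert_sdiff_singleton (h : CircuitHyperplane M X) {x y : α}
    (hx : x ∈ X) (hy : y ∈ M.E \ X) : M.IsBase (insert y (X \ {x})) := by
  have hind : M.Indep (X \ {x}) := h.1.2 _ (sdiff_singleton_ssubset.2 hx)
  have hcl : M.closure (X \ {x}) = X := by
    have hxc : x ∈ M.closure (X \ {x}) := by
      by_contra hcon
      rw [hind.notMem_closure_iff_of_notMem (fun h => h.2 rfl) (h.1.1.subset_ground hx),
        insert_sdiff_singleton, insert_eq_of_mem hx] at hcon
      exact h.1.1.not_indep hcon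
    rw [← closure_insert_eq_of_mem_closure hxc, insert_sdiff_singleton, insert_eq_of_mem hx,
      h.2.1.closure]
  have hyc : y ∉ M.closure (X \ {x}) := by
    rw [hcl]
    exact hy.2
  have hins := (hind.notMem_closure_iff_of_notMem (fun h => hy.2 h.1) hy.1).1 hyc
  rw [hins.isBase_iff_ground_subset_closure]
  refine (h.2.2.2 (M.closure (insert y (X \ {x}))) (M.isFlat_closure _) ⟨?_, fun hsub => ?_⟩).ge
  · conv_lhs => rw [← hcl]
    exact M.closure_subset_closure (subset_insert _ _)
  · exact hy.2 (hsub (M.mem_closure_of_mem (mem_insert _ _) hins.subset_ground))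

lemma IsRelaxation.exists_isRep_zmod_three (hrel : IsRelaxation M M' X) (hE : M.E.Finite)
    (hM : Representable M GF4) (hM' : Representable M' GF4) :
    ∃ ψ : α → X → ZMod 3, IsRep (ZMod 3) M ψ := by
  obtain ⟨n, φ, hφ⟩ := hM
  obtain ⟨n', φ', hφ'⟩ := hM'
  have hK : Nat.card GF4 = 4 := GaloisField.card 2 2 two_ne_zero
  exact exists_isRep_zmod_three_of_relaxation hK (φ := φ) (φ' := φ') hφ hφ' hE hrel.2.1
    hrel.1.nonempty hrel.1.ssubset_ground hrel.2.2 hrel.1.not_isBase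
    fun x hx y hy => hrel.1.isBase_insert_sdiff_singleton hx hy

end Relax

section Minors

variable {α F V : Type*} [Field F] [AddCommGroup V] [Module F V]

lemma Relax.MinorOf.exists_isRep {N M : Matroid α} (h : Relax.MinorOf N M) {φ : α → V}
    (hM : IsRep F M φ) : ∃ W : Submodule F V, IsRep F N (W.mkQ ∘ φ) := by
  obtain ⟨C, D, hC, -, -, rfl⟩ := h
  obtain ⟨B, hB⟩ := M.exists_isBasis C
  refine ⟨Submodule.span F (φ '' B), fun S hS => ?_⟩
  change (M ／ C ＼ D).Indep S ↔ _
  have hS' : S ⊆ M.E \ C ∧ Disjoint S D := subset_sdiff.1 hS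
  have hSC : Disjoint S C := (subset_sdiff.1 hS'.1).2
  have hdisj : Disjoint B S := (hSC.mono_right hB.subset).symm
  rw [delete_indep_iff, and_iff_left hS'.2, hB.contract_indep_iff, and_iff_left hSC.symm,
    hM _ (union_subset (hS'.1.trans sdiff_subset) (hB.subset.trans hC)), union_comm,
    ← ((hM B (hB.subset.trans hC)).1 hB.indep).quotient_iff_union hdisj]

lemma Relax.IsUniform.isBase {N : Matroid α} {r n : ℕ} (h : Relax.IsUniform N r n) {B : Set α}
    (hB : B ⊆ N.E) (hr : B.ncard = r) : N.IsBase B := by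
  obtain ⟨B', hB', hBB'⟩ := ((h.2.2 B hB).2 hr.le).exists_isBase_superset
  have := (h.2.2 B' hB'.subset_ground).1 hB'.indep
  rwa [eq_of_subset_of_ncard_le hBB' (by omega) (h.1.subset hB'.subset_ground)]

lemma exists_minor_eq_zmod_three (a b : Fin 3 → ZMod 3) (ha : ∀ i, a i ≠ 0) (hb : ∀ i, b i ≠ 0) :
    ∃ i j, i ≠ j ∧ a i * b j = b i * a j := by
  revert ha hb
  revert a b
  decide

lemma IsRep.not_isUniform_two_five [Module (ZMod 3) V] {N : Matroid α} {φ : α → V}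
    (hN : IsRep (ZMod 3) N φ) : ¬ Relax.IsUniform N 2 5 := by
  intro h
  obtain ⟨e, he, heE⟩ := exists_fin_enum h.1 h.2.1
  have heE' : ∀ k, e k ∈ N.E := fun k => heE ▸ mem_range_self k
  have hne : e 0 ≠ e 1 := he.ne (by decide)
  have hZ : N.IsBase {e 0, e 1} := h.isBase (pair_subset (heE' 0) (heE' 1)) (ncard_pair hne)
  obtain ⟨D, hD1, hD2, -⟩ := hN.exists_matrix h.1 hZ
  have hf : ∀ k : Fin 3, e (Fin.natAdd 2 k) ∈ N.E \ {e 0, e 1} := by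
    refine fun k => ⟨heE' _, ?_⟩
    simp only [mem_insert_iff, mem_singleton_iff, he.eq_iff]
    revert k
    decide
  have hD : ∀ j ∈ ({e 0, e 1} : Set α), ∀ k : Fin 3, D (e (Fin.natAdd 2 k)) j ≠ 0 := by
    intro j hj k
    rw [← hD1 j hj _ (hf k)]
    refine h.isBase (insert_subset (heE' _) (sdiff_subset.trans hZ.subset_ground)) ?_
    rw [ncard_insert_sdiff_singleton (toFinite _) hj (hf k).2, ncard_pair hne]
  obtain ⟨k, l, hkl, hD'⟩ := exists_minor_eq_zmod_three _ _ (hD (e 0) (by simp))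
    (hD (e 1) (by simp))
  have hkl' : e (Fin.natAdd 2 k) ≠ e (Fin.natAdd 2 l) :=
    he.ne fun h => hkl (Fin.natAdd_injective _ _ h)
  refine (hD2 (e 0) (by simp) (e 1) (by simp) _ (hf k) _ (hf l) hne hkl').1 ?_ hD'
  rw [Set.sdiff_self, empty_union]
  exact h.isBase (pair_subset (heE' _) (heE' _)) (ncard_pair hkl')

lemma IsRep.not_isUniform_three_five [Module (ZMod 3) V] {N : Matroid α} {φ : α → V}
    (hN : IsRep (ZMod 3) N φ) : ¬ Relax.IsUniform N 3 5 := by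
  intro h
  obtain ⟨e, he, heE⟩ := exists_fin_enum h.1 h.2.1
  have heE' : ∀ k, e k ∈ N.E := fun k => heE ▸ mem_range_self k
  set f : Fin 3 → α := fun k => e (Fin.castAdd 2 k) with hf
  have hfi : Function.Injective f := he.comp (Fin.castAdd_injective _ _)
  have hfE : range f ⊆ N.E := by
    rintro _ ⟨k, rfl⟩
    exact heE' _
  have hcard : (range f).ncard = 3 := by
    rw [← image_univ, ncard_image_of_injective _ hfi, ncard_univ, Nat.card_fin]
  have hZ : N.IsBase (range f) := h.isBase hfE hcard
  obtain ⟨D, hD1, hD2, -⟩ := hN.exists_matrix h.1 hZ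
  have hg : ∀ k : Fin 2, e (Fin.natAdd 3 k) ∈ N.E \ range f := by
    refine fun k => ⟨heE' _, ?_⟩
    rintro ⟨l, hl⟩
    refine absurd (he hl) ?_
    clear hl
    revert k l
    decide
  have hD : ∀ (i : Fin 2) (k : Fin 3), D (e (Fin.natAdd 3 i)) (f k) ≠ 0 := by
    intro i k
    rw [← hD1 _ (mem_range_self k) _ (hg i)]
    refine h.isBase (insert_subset (heE' _) (sdiff_subset.trans hfE)) ?_
    rw [ncard_insert_sdiff_singleton (toFinite _) (mem_range_self k) (hg i).2, hcard]
  obtain ⟨k, l, hkl, hD'⟩ := exists_minor_eq_zmod_three _ _ (hD 0) (hD 1)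
  have hne : e (Fin.natAdd 3 (0 : Fin 2)) ≠ e (Fin.natAdd 3 (1 : Fin 2)) := he.ne (by decide)
  refine (hD2 (f k) (mem_range_self k) (f l) (mem_range_self l) _ (hg 0) _ (hg 1) (hfi.ne hkl)
    hne).1 ?_ (hD'.trans (mul_comm _ _))
  refine h.isBase (union_subset (sdiff_subset.trans hfE) (pair_subset (heE' _) (heE' _))) ?_
  rw [← range_vec_two, ← range_vec_two, ncard_sdiff_range_union_range (toFinite _)
    (injective_vec_two (hfi.ne hkl)) ?_ (injective_vec_two hne) ?_, hcard]
  · simp [Fin.forall_fin_two]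
  · rw [Fin.forall_fin_two]
    exact ⟨(hg 0).2, (hg 1).2⟩

end Minors

/-- Let `M` and `M'` be GF(4)-representable (finite) matroids such that `M`
is connected, `M'` is 3-connected, and `M'` is obtained from `M` by relaxing a
circuit-hyperplane `X`. If `M'` has a `{U_{2,5}, U_{3,5}}`-minor, then `M` has no
`{U_{2,5}, U_{3,5}}`-minor. -/
theorem statement8 {α : Type*} (M M' : Matroid α) (X : Set α)
    (hfin : M.E.Finite)
    (hrepM : Relax.Representable M Relax.GF4)
    (hrepM' : Relax.Representable M' Relax.GF4)
    (hconn : Relax.Connected M) (h3c : Relax.ThreeConnected M')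
    (hrel : Relax.IsRelaxation M M' X)
    (h : Relax.HasU25U35Minor M') :
    ¬ Relax.HasU25U35Minor M := by
  obtain ⟨ψ, hψ⟩ := hrel.exists_isRep_zmod_three hfin hrepM hrepM'
  rintro (⟨N, hN, hU⟩ | ⟨N, hN, hU⟩) <;> obtain ⟨W, hW⟩ := hN.exists_isRep hψ
  · exact hW.not_isUniform_two_five hU
  · exact hW.not_isUniform_three_five hU
end
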